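/- arXiv:1701.05791 — 3 statements merged into one kernel-verified Lean document; each statement's English description precedes it below -/
import Mathlib

section
/- Suppose κ is an infinite cardinal with κ^{<κ} = κ and P is a weakly κ-scattered linear order of cardinality at most κ. Then there is a weakly κ-scattered linear order T of cardinality at most κ such that T → (P, n)² for all n < ω. -/
open Cardinal

universe u

/-- A linear order `T` is `κ`-saturated if it is nonempty and for all subsets `A, B ⊆ T`
of size `< κ` with every element of `A` below every element of `B`, there is an element
strictly between them. -/
def KSaturated (κ : Cardinal.{u}) (T : Type u) [LinearOrder T] : Prop :=
  Nonempty T ∧ ∀ A B : Set T, #A < κ → #B < κ → (∀ a ∈ A, ∀ b ∈ B, a < b) →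
    ∃ c : T, (∀ a ∈ A, a < c) ∧ (∀ b ∈ B, c < b)

/-- A linear order is weakly `κ`-scattered if it has no `κ`-saturated suborder. -/
def WeaklyKScattered (κ : Cardinal.{u}) (P : Type u) [LinearOrder P] : Prop :=
  ∀ S : Set P, ¬ KSaturated κ S

/-- `T → (P, n)²`: for every 2-coloring `f` of the pairs of `T`, either there is a
suborder of `T` order-isomorphic to `P` all of whose pairs receive color 0, or there
is an `n`-element subset of `T` all of whose pairs receive color 1. -/
def PartPair (T : Type u) [LinearOrder T] (P : Type u) [LinearOrder P] (n : ℕ) : Prop :=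
  ∀ f : T → T → Fin 2,
    (∃ S : Set T, Nonempty (P ≃o S) ∧ ∀ a ∈ S, ∀ b ∈ S, a < b → f a b = 0) ∨
    (∃ S : Finset T, S.card = n ∧ ∀ a ∈ S, ∀ b ∈ S, a < b → f a b = 1)

theorem rec_exists {ι : Type*} (r : ι → ι → Prop) (wf : WellFounded r) {F : ι → Type*}
    (Q : ∀ i, (∀ j, r j i → F j) → F i → Prop) (H : ∀ i h, ∃ y, Q i h y) :
    ∃ h : ∀ i, F i, ∀ i, Q i (fun j _ => h j) (h i) := by
  choose y hy using H
  refine ⟨wf.fix y, fun i => ?_⟩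
  have := hy i (fun j _ => wf.fix y j)
  rw [wf.fix_eq]
  exact this

theorem ksat_transfer {κ : Cardinal.{u}} {X Y : Type u} [LinearOrder X] [LinearOrder Y]
    (e : X ≃o Y) (h : KSaturated κ X) : KSaturated κ Y := by
  obtain ⟨⟨x⟩, h⟩ := h
  refine ⟨⟨e x⟩, fun A B hA hB hAB => ?_⟩
  obtain ⟨c, h1, h2⟩ := h (e.symm '' A) (e.symm '' B) (mk_image_le.trans_lt hA)
    (mk_image_le.trans_lt hB) (by
      rintro _ ⟨a, ha, rfl⟩ _ ⟨b, hb, rfl⟩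
      exact e.symm.strictMono (hAB a ha b hb))
  refine ⟨e c, fun a ha => ?_, fun b hb => ?_⟩
  · have := h1 _ ⟨a, ha, rfl⟩
    simpa using e.strictMono this
  · have := h2 _ ⟨b, hb, rfl⟩
    simpa using e.strictMono this

theorem wks_not {κ : Cardinal.{u}} {X P : Type u} [LinearOrder X] [LinearOrder P]
    (hP : WeaklyKScattered κ P) (hX : KSaturated κ X) (g : X → P) (hg : StrictMono g) : False :=
  hP (Set.range g) (ksat_transfer (hg.orderIso g) hX)

theorem ksat_Ioo {κ : Cardinal.{u}} (hκ : ℵ₀ ≤ κ) {X : Type u} [LinearOrder X]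
    (hX : KSaturated κ X) {a b : X} (hab : a < b) : KSaturated κ (Set.Ioo a b) := by
  have key : ∀ A B : Set (Set.Ioo a b), #A < κ → #B < κ → (∀ a ∈ A, ∀ b ∈ B, a < b) →
      ∃ c : Set.Ioo a b, (∀ a ∈ A, a < c) ∧ (∀ b ∈ B, c < b) := by
    intro A B hA hB hAB
    obtain ⟨c, h1, h2⟩ := hX.2 (insert a (Subtype.val '' A)) (insert b (Subtype.val '' B))
      (mk_insert_le.trans_lt (add_lt_of_lt hκ (mk_image_le.trans_lt hA) (one_lt_aleph0.trans_le hκ)))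
      (mk_insert_le.trans_lt (add_lt_of_lt hκ (mk_image_le.trans_lt hB) (one_lt_aleph0.trans_le hκ)))
      (by
        rintro _ (rfl | ⟨x, hx, rfl⟩) _ (rfl | ⟨y, hy, rfl⟩)
        · exact hab
        · exact y.2.1
        · exact x.2.2
        · exact hAB x hx y hy)
    refine ⟨⟨c, h1 a (Or.inl rfl), h2 b (Or.inl rfl)⟩, fun x hx => ?_, fun x hx => ?_⟩
    · exact h1 _ (Or.inr ⟨x, hx, rfl⟩)
    · exact h2 _ (Or.inr ⟨x, hx, rfl⟩)
  refine ⟨?_, key⟩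
  obtain ⟨c, -, -⟩ := key ∅ ∅ (by simpa using aleph0_pos.trans_le hκ)
    (by simpa using aleph0_pos.trans_le hκ) (by simp)
  exact ⟨c⟩

theorem wks_wf {κ : Cardinal.{u}} (hκ : ℵ₀ ≤ κ) {W : Type u} [LinearOrder W] [WellFoundedLT W] :
    WeaklyKScattered κ W := by
  rintro S ⟨⟨x⟩, h⟩
  have hwf : WellFounded ((· < ·) : S → S → Prop) := wellFounded_lt
  have hne : (Set.univ : Set S).Nonempty := ⟨x, trivial⟩
  obtain ⟨c, -, h2⟩ := h ∅ {hwf.min Set.univ hne} (by simpa using aleph0_pos.trans_le hκ)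
    (by simpa using one_lt_aleph0.trans_le hκ) (by simp)
  exact hwf.not_lt_min Set.univ (Set.mem_univ c) (h2 _ rfl)

theorem cast_lt {P : Type u} (F : P → Type u) [∀ p, LinearOrder (F p)] (u v : Σ p, F p) (w : P)
    (h1 : u.1 = w) (h2 : v.1 = w) (h : u.1 = v.1) (h' : h ▸ u.2 < v.2) :
    (h1 ▸ u.2 : F w) < h2 ▸ v.2 := by
  rcases u with ⟨u1, u2⟩
  rcases v with ⟨v1, v2⟩
  dsimp only at h1 h2
  subst h1
  subst h2
  exact h'

theorem wks_sigma {κ : Cardinal.{u}} (hκ : ℵ₀ ≤ κ) {P : Type u} [LinearOrder P]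
    (F : P → Type u) [∀ p, LinearOrder (F p)] (hP : WeaklyKScattered κ P)
    (hF : ∀ p, WeaklyKScattered κ (F p)) : WeaklyKScattered κ (Σₗ p, F p) := by
  intro S hS
  by_cases h : ∃ a b : S, a < b ∧ a.1.1 = b.1.1
  · obtain ⟨a, b, hab, he⟩ := h
    have mono : ∀ x y : S, x < y → x.1.1 ≤ y.1.1 := by
      rintro ⟨x, _⟩ ⟨y, _⟩ hxy
      rcases (Sigma.Lex.lt_def.1 hxy) with h | ⟨h, -⟩
      · exact h.le
      · exact h.le
    have hfst : ∀ x : Set.Ioo a b, x.1.1.1 = a.1.1 := fun x =>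
      le_antisymm (he ▸ mono _ _ x.2.2) (mono _ _ x.2.1)
    refine wks_not (hF a.1.1) (ksat_Ioo hκ hS hab) (fun x => (hfst x) ▸ x.1.1.2) ?_
    rintro x y hxy
    have hxy' : x.1.1 < y.1.1 := hxy
    rcases (Sigma.Lex.lt_def.1 hxy') with h | ⟨h, h'⟩
    · rw [hfst x, hfst y] at h
      exact absurd h (lt_irrefl _)
    · exact cast_lt F _ _ _ (hfst x) (hfst y) h h'
  · push Not at h
    refine wks_not hP hS (fun x => x.1.1) ?_
    rintro ⟨x, hx⟩ ⟨y, hy⟩ hxy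
    rcases (Sigma.Lex.lt_def.1 hxy) with h' | ⟨h', -⟩
    · exact h'
    · exact absurd h' (h _ _ hxy)

theorem wks_pi {κ : Cardinal.{u}} (hκ : ℵ₀ ≤ κ) {R : Type u} [LinearOrder R]
    {ι : Type u} [LinearOrder ι] [WellFoundedLT ι] (hι : #ι < κ)
    (hR : WeaklyKScattered κ R) : WeaklyKScattered κ (Lex (ι → R)) := by
  intro S hS
  have hD : ∀ a b : S, a < b → ∃ i, (∀ j < i, (ofLex a.1) j = (ofLex b.1) j) ∧
    (ofLex a.1) i < (ofLex b.1) i := fun a b h => h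
  choose D hD1 hD2 using hD
  -- points between agree with the endpoints below the first difference
  have btw : ∀ a b c : S, ∀ h : a < b, a ≤ c → c ≤ b → ∀ j < D a b h,
      (ofLex c.1) j = (ofLex a.1) j := by
    intro a b c h hac hcb j hj
    induction j using WellFoundedLT.induction with
    | _ j ih =>
      have e : ∀ k < j, (ofLex c.1) k = (ofLex a.1) k := fun k hk => ih k hk (hk.trans hj)
      apply le_antisymm
      · by_contra hlt
        push Not at hlt
        rw [hD1 a b h j hj] at hlt
        have : b < c := ⟨j, fun k hk => by
          show (ofLex b.1) k = (ofLex c.1) k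
          rw [e k hk, hD1 a b h k (hk.trans hj)], hlt⟩
        exact absurd hcb this.not_ge
      · by_contra hlt
        push Not at hlt
        have : c < a := ⟨j, e, hlt⟩
        exact absurd hac this.not_ge
  have step : ∀ a b : S, ∀ h : a < b, ∃ a' b' : S, ∃ h' : a' < b', a < a' ∧ b' < b ∧
      D a b h < D a' b' h' := by
    intro a b h
    by_contra hno
    push Not at hno
    refine wks_not hR (ksat_Ioo hκ hS h) (fun x => (ofLex x.1.1) (D a b h)) ?_
    intro x y hxy
    have hxy' : x.1 < y.1 := hxy
    have h1 := hno x.1 y.1 hxy' x.2.1 y.2.2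
    have h2 : D x.1 y.1 hxy' = D a b h := by
      apply le_antisymm h1
      by_contra hlt
      push Not at hlt
      have := hD2 x.1 y.1 hxy'
      rw [btw a b x.1 h x.2.1.le x.2.2.le _ hlt, btw a b y.1 h y.2.1.le y.2.2.le _ hlt] at this
      exact lt_irrefl _ this
    have := hD2 x.1 y.1 hxy'
    rwa [h2] at this
  let Z := {p : S × S // p.1 < p.2}
  let rel : Z → Z → Prop := fun p q => p = q ∨
    (p.1.1 < q.1.1 ∧ q.1.2 < p.1.2 ∧ D _ _ p.2 < D _ _ q.2)
  have trans : ∀ {a b c : Z}, rel a b → rel b c → rel a c := by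
    rintro a b c (rfl | h1) (rfl | h2)
    · exact Or.inl rfl
    · exact Or.inr h2
    · exact Or.inr h1
    · exact Or.inr ⟨h1.1.trans h2.1, h2.2.1.trans h1.2.1, h1.2.2.trans h2.2.2⟩
  obtain ⟨m, hm⟩ := exists_maximal_of_chains_bounded (r := rel) (fun C hC => by
    have inj : Function.Injective (fun c : C => D _ _ c.1.2) := by
      intro c d hcd
      by_contra hne
      have hne' : c.1 ≠ d.1 := fun h => hne (Subtype.ext h)
      rcases hC c.2 d.2 hne' with (h | h) | (h | h)
      · exact hne' h
      · exact h.2.2.ne hcd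
      · exact hne' h.symm
      · exact h.2.2.ne hcd.symm
    have hcard : #C < κ := (mk_le_of_injective inj).trans_lt hι
    by_cases hmax : ∃ c ∈ C, ∀ d ∈ C, rel d c
    · obtain ⟨c, -, h⟩ := hmax
      exact ⟨c, h⟩
    push Not at hmax
    have nxt : ∀ c ∈ C, ∃ d ∈ C, c.1.1 < d.1.1 ∧ d.1.2 < c.1.2 ∧ D _ _ c.2 < D _ _ d.2 := by
      intro c hc
      obtain ⟨d, hd, hdc⟩ := hmax c hc
      refine ⟨d, hd, ?_⟩
      have hne : c ≠ d := fun h => hdc (Or.inl h.symm)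
      rcases hC hc hd hne with (h | h) | h
      · exact absurd h hne
      · exact h
      · exact absurd h hdc
    obtain ⟨u, hu1, hu2⟩ := hS.2 ((fun c : Z => c.1.1) '' C) ((fun c : Z => c.1.2) '' C)
      (mk_image_le.trans_lt hcard) (mk_image_le.trans_lt hcard) (by
        rintro _ ⟨c, hc, rfl⟩ _ ⟨d, hd, rfl⟩
        by_cases hcd : c = d
        · subst hcd; exact c.2
        rcases hC hc hd hcd with (h | h) | (h | h)
        · exact absurd h hcd
        · exact h.1.trans d.2
        · exact absurd h.symm hcd
        · exact c.2.trans h.2.1)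
    obtain ⟨v, hv1, hv2⟩ := hS.2 {u} ((fun c : Z => c.1.2) '' C)
      (by simpa using one_lt_aleph0.trans_le hκ) (mk_image_le.trans_lt hcard) (by
        rintro _ rfl b hb
        exact hu2 b hb)
    have huv : u < v := hv1 u rfl
    refine ⟨⟨(u, v), huv⟩, fun c hc => Or.inr ⟨hu1 _ ⟨c, hc, rfl⟩, hv2 _ ⟨c, hc, rfl⟩, ?_⟩⟩
    obtain ⟨d, hd, -, -, h3⟩ := nxt c hc
    refine h3.trans_le ?_
    by_contra hlt
    push Not at hlt
    have hdu : d.1.1 < u := hu1 _ ⟨d, hd, rfl⟩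
    have hvd : v < d.1.2 := hv2 _ ⟨d, hd, rfl⟩
    have := hD2 u v huv
    rw [btw _ _ u d.2 hdu.le (huv.trans hvd).le _ hlt,
      btw _ _ v d.2 (hdu.trans huv).le hvd.le _ hlt] at this
    exact lt_irrefl _ this) trans
  obtain ⟨a', b', h', h1, h2, h3⟩ := step m.1.1 m.1.2 m.2
  rcases hm ⟨(a', b'), h'⟩ (Or.inr ⟨h1, h2, h3⟩) with h | h
  · have : a' = m.1.1 := by rw [← h]
    exact h1.ne this.symm
  · exact lt_asymm h1 h.1

theorem cover_pi {R ι : Type u} [LinearOrder R] [LinearOrder ι] [WellFoundedLT ι]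
    (U : ι → Lex (ι → R) → Prop) (hU : ∀ x, ∃ i, U i x) :
    ∃ i, ∃ g : R → Lex (ι → R), StrictMono g ∧ ∀ r, U i (g r) := by
  by_contra hno
  obtain ⟨x, hx⟩ := rec_exists (ι := ι) (· < ·) wellFounded_lt (F := fun _ => R)
    (fun i h r => ∀ x : ι → R, (∀ j (hj : j < i), x j = h j hj) → x i = r → ¬ U i (toLex x))
    (by
      intro i h
      by_contra hc
      push Not at hc
      choose x hx1 hx2 hx3 using hc
      refine hno ⟨i, fun r => toLex (x r), fun r s hrs => ?_, hx3⟩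
      refine ⟨i, fun j hj => ?_, ?_⟩
      · show x r j = x s j
        rw [hx1 r j hj, hx1 s j hj]
      · show x r i < x s i
        rwa [hx2, hx2])
  obtain ⟨i, hi⟩ := hU (toLex x)
  exact hx i x (fun _ _ => rfl) rfl hi

theorem partPair_mono {T T' P : Type u} [LinearOrder T] [LinearOrder T'] [LinearOrder P] {n : ℕ}
    (g : T → T') (hg : StrictMono g) (h : PartPair T P n) : PartPair T' P n := by
  intro f
  rcases h (fun a b => f (g a) (g b)) with ⟨S, ⟨e⟩, hS⟩ | ⟨S, hc, hS⟩
  · left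
    refine ⟨g '' S, ⟨e.trans ((hg.strictMonoOn S).orderIso g S)⟩, ?_⟩
    rintro _ ⟨a, ha, rfl⟩ _ ⟨b, hb, rfl⟩ hab
    exact hS a ha b hb (hg.lt_iff_lt.1 hab)
  · right
    refine ⟨S.map ⟨g, hg.injective⟩, by simpa using hc, ?_⟩
    intro a ha' b hb' hab
    obtain ⟨a, ha'', rfl⟩ := Finset.mem_map.1 ha'
    obtain ⟨b, hb'', rfl⟩ := Finset.mem_map.1 hb'
    exact hS a ha'' b hb'' (hg.lt_iff_lt.1 hab)

theorem step_part {W P R : Type u} [LinearOrder W] [WellFoundedLT W] [LinearOrder P]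
    [LinearOrder R] (hne : Nonempty R) (e : P → W) (he : Function.Injective e) {n : ℕ} (hR : PartPair R P n) :
    PartPair (Σₗ p : P, Lex (Set.Iio (e p) → R)) P (n + 1) := by
  classical
  intro f
  let T := Σₗ p : P, Lex (Set.Iio (e p) → R)
  let c : T → T → Fin 2 := fun x y => if x < y then f x y else f y x
  let mk : ∀ p : P, Lex (Set.Iio (e p) → R) → T := fun p y => toLex ⟨p, y⟩
  have mk_mono : ∀ p, StrictMono (mk p) := fun p a b h => Sigma.Lex.right _ _ h
  by_cases hA : ∃ x : T, ∃ g : R → T, StrictMono g ∧ ∀ r, g r ≠ x ∧ c x (g r) = 1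
  · obtain ⟨x, g, hg, hgx⟩ := hA
    rcases hR (fun a b => f (g a) (g b)) with ⟨S, ⟨e⟩, hS⟩ | ⟨S, hc, hS⟩
    · left
      refine ⟨g '' S, ⟨e.trans ((hg.strictMonoOn S).orderIso g S)⟩, ?_⟩
      rintro _ ⟨a, ha, rfl⟩ _ ⟨b, hb, rfl⟩ hab
      exact hS a ha b hb (hg.lt_iff_lt.1 hab)
    · right
      have hx : x ∉ S.map ⟨g, hg.injective⟩ := by
        intro h
        obtain ⟨a, ha, h⟩ := Finset.mem_map.1 h
        exact (hgx a).1 h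
      refine ⟨insert x (S.map ⟨g, hg.injective⟩), ?_, ?_⟩
      · rw [Finset.card_insert_of_notMem hx, Finset.card_map, hc]
      · intro a ha b hb hab
        rcases Finset.mem_insert.1 ha with rfl | ha'
        · rcases Finset.mem_insert.1 hb with rfl | hb'
          · exact absurd hab (lt_irrefl _)
          · obtain ⟨b, hb'', rfl⟩ := Finset.mem_map.1 hb'
            have := (hgx b).2
            simp only [c] at this
            exact (if_pos (show a < g b from hab)).symm.trans this
        · obtain ⟨a, ha'', rfl⟩ := Finset.mem_map.1 ha'
          rcases Finset.mem_insert.1 hb with rfl | hb'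
          · have := (hgx a).2
            simp only [c] at this
            exact (if_neg (show ¬ b < g a from hab.not_gt)).symm.trans this
          · obtain ⟨b, hb'', rfl⟩ := Finset.mem_map.1 hb'
            exact hS a ha'' b hb'' (hg.lt_iff_lt.1 hab)
  · left
    obtain ⟨h, hh⟩ := rec_exists (ι := P) (fun q p => e q < e p) (InvImage.wf e wellFounded_lt)
      (F := fun p => Lex (Set.Iio (e p) → R))
      (fun p h y => ∀ q (hq : e q < e p), c (mk q (h q hq)) (mk p y) ≠ 1) (by
        intro p h
        by_contra hc
        push Not at hc
        obtain ⟨i, g, hg, hgi⟩ := cover_pi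
          (fun (i : Set.Iio (e p)) y => ∃ q, ∃ hq : e q < e p, e q = i.1 ∧
            c (mk q (h q hq)) (mk p y) = 1)
          (fun y => by
            obtain ⟨q, hq, hy⟩ := hc y
            exact ⟨⟨e q, hq⟩, q, hq, rfl, hy⟩)
        · obtain ⟨r0⟩ := hne
          obtain ⟨q, hq, hqi, -⟩ := hgi r0
          refine hA ⟨mk q (h q hq), fun r => mk p (g r), (mk_mono p).comp hg, fun r => ⟨?_, ?_⟩⟩
          · intro heq
            have : p = q := congrArg (fun z : T => (ofLex z).1) heq
            subst this
            exact lt_irrefl _ hq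
          · obtain ⟨q', hq', hqi', hcol⟩ := hgi r
            have : q' = q := he (hqi'.trans hqi.symm)
            subst this
            exact hcol)
    have hm : StrictMono (fun p => mk p (h p)) := fun p q hpq => Sigma.Lex.left _ _ hpq
    refine ⟨Set.range (fun p => mk p (h p)), ⟨hm.orderIso _⟩, ?_⟩
    rintro _ ⟨p, rfl⟩ _ ⟨q, rfl⟩ hpq
    have hlt : p < q := hm.lt_iff_lt.1 hpq
    have hfin : ∀ z : Fin 2, z ≠ 1 → z = 0 := by decide
    apply hfin
    rcases lt_trichotomy (e p) (e q) with h' | h' | h'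
    · have := hh q p h'
      simp only [c] at this
      rwa [if_pos hpq] at this
    · exact absurd (he h') hlt.ne
    · have := hh p q h'
      simp only [c] at this
      rwa [if_neg hpq.not_gt] at this

theorem all_n (κ : Cardinal.{u}) (hκ : ℵ₀ ≤ κ) (hpow : κ ^< κ = κ)
    (P : Type u) [LinearOrder P] (hP : #P ≤ κ) (hws : WeaklyKScattered κ P) (n : ℕ) :
    ∃ (T : Type u) (_ : LinearOrder T), #T ≤ κ ∧ WeaklyKScattered κ T ∧ PartPair T P n := by
  by_cases hPe : IsEmpty P
  · exact ⟨P, inferInstance, hP, hws, fun f => Or.inl ⟨Set.univ, ⟨OrderIso.Set.univ.symm⟩,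
      fun a => hPe.elim a⟩⟩
  rw [not_isEmpty_iff] at hPe
  suffices h : ∃ (T : Type u) (_ : LinearOrder T), #T ≤ κ ∧ WeaklyKScattered κ T ∧
      PartPair T P n ∧ Nonempty T by
    obtain ⟨T, i, h1, h2, h3, -⟩ := h
    exact ⟨T, i, h1, h2, h3⟩
  induction n with
  | zero => exact ⟨P, inferInstance, hP, hws, fun f => Or.inr ⟨∅, rfl, by simp⟩, hPe⟩
  | succ n ih =>
    obtain ⟨R, _, hRc, hRw, hRp, hRn⟩ := ih
    have : #P ≤ #κ.ord.ToType := by simpa using hP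
    obtain ⟨e⟩ := this
    refine ⟨Σₗ p : P, Lex (Set.Iio (e p) → R), inferInstance, ?_, ?_, step_part hRn e e.injective hRp,
      ⟨toLex ⟨hPe.some, toLex fun _ => hRn.some⟩⟩⟩
    · have h1 : ∀ p, #(Lex (Set.Iio (e p) → R)) ≤ κ := by
        intro p
        have : #(Lex (Set.Iio (e p) → R)) = #R ^ #(Set.Iio (e p)) := by
          rw [Cardinal.power_def]; rfl
        rw [this]
        calc _ ≤ κ ^ #(Set.Iio (e p)) := power_le_power_right hRc
          _ ≤ κ ^< κ := le_powerlt _ (mk_Iio_toType_ord_lt _)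
          _ = κ := hpow
      have : #(Σₗ p : P, Lex (Set.Iio (e p) → R)) = Cardinal.sum
        (fun p : P => #(Lex (Set.Iio (e p) → R))) := mk_sigma _
      rw [this]
      calc _ ≤ Cardinal.sum (fun _ : P => κ) := sum_le_sum _ _ h1
        _ = #P * κ := by simp
        _ ≤ κ * κ := by gcongr
        _ = κ := mul_eq_self hκ
    · exact wks_sigma hκ _ hws (fun p => wks_pi hκ (mk_Iio_toType_ord_lt _) hRw)

theorem main_aux (κ : Cardinal.{u}) (hκ : ℵ₀ ≤ κ) (hpow : κ ^< κ = κ)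
    (P : Type u) [LinearOrder P] (hP : #P ≤ κ) (hws : WeaklyKScattered κ P) :
    ∃ (T : Type u) (_ : LinearOrder T), #T ≤ κ ∧ WeaklyKScattered κ T ∧
      ∀ n : ℕ, PartPair T P n := by
  choose T inst hc hw hp using all_n κ hκ hpow P hP hws
  have : WellFoundedLT (ULift.{u} ℕ) := ⟨InvImage.wf ULift.down wellFounded_lt⟩
  refine ⟨Σₗ n : ULift.{u} ℕ, T n.down, inferInstance, ?_,
    wks_sigma hκ _ (wks_wf hκ) (fun n => hw _), fun n => ?_⟩
  · have : #(Σₗ n : ULift.{u} ℕ, T n.down) = Cardinal.sum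
        (fun n : ULift.{u} ℕ => #(T n.down)) := mk_sigma _
    rw [this]
    calc _ ≤ Cardinal.sum (fun _ : ULift.{u} ℕ => κ) := sum_le_sum _ _ (fun n => hc _)
      _ = ℵ₀ * κ := by simp
      _ ≤ κ * κ := by gcongr
      _ = κ := mul_eq_self hκ
  · exact partPair_mono (fun x => (toLex ⟨⟨n⟩, x⟩ : Σₗ n : ULift.{u} ℕ, T n.down))
      (fun a b h => Sigma.Lex.right _ _ h) (hp n)

/-- Suppose `κ` is an infinite cardinal with `κ^{<κ} = κ` and `P` is a
weakly `κ`-scattered linear order of cardinality at most `κ`.  Then there is a weakly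
`κ`-scattered linear order `T` of cardinality at most `κ` such that `T → (P, n)²` for
all `n < ω`. -/
theorem stmt8 (κ : Cardinal.{u}) (hκ : ℵ₀ ≤ κ) (hpow : κ ^< κ = κ)
    (P : Type u) [LinearOrder P] (hP : #P ≤ κ) (hws : WeaklyKScattered κ P) :
    ∃ (T : Type u) (_ : LinearOrder T), #T ≤ κ ∧ WeaklyKScattered κ T ∧
      ∀ n : ℕ, PartPair T P n := by
  exact main_aux κ hκ hpow P hP hws
end

section
/- Suppose κ is a regular uncountable cardinal. Then there is a linear order of cardinality κ that is weakly κ-scattered but not (κ, κ)-scattered. -/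
open Cardinal

universe u

/-- A linear order is `κ`-dense if it has more than one element and every open interval
`(a,b)` with `a < b` has at least `κ` elements. -/
def KDense (κ : Cardinal.{u}) (P : Type u) [LinearOrder P] : Prop :=
  Nontrivial P ∧ ∀ a b : P, a < b → κ ≤ #{c : P // a < c ∧ c < b}

/-- A linear order is `κ`-scattered if it has no `κ`-dense suborder. -/
def KScattered (κ : Cardinal.{u}) (P : Type u) [LinearOrder P] : Prop :=
  ∀ S : Set P, ¬ KDense κ S

open Set in
theorem W_bdd {κ : Cardinal.{u}} (hreg : κ.IsRegular) (B : Set κ.ord.ToType) (hB : #B < κ) :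
    ∃ c, ∀ b ∈ B, b < c := by
  by_contra! h
  have h1 : (⋃ b ∈ B, Iic b) = (univ : Set κ.ord.ToType) := by
    ext c
    obtain ⟨b, hb, hc⟩ := h c
    simp only [mem_iUnion, mem_univ, iff_true]
    exact ⟨b, hb, hc⟩
  have h2 : #(⋃ b ∈ B, Iic b : Set κ.ord.ToType) < κ := by
    rw [card_biUnion_lt_iff_forall_of_isRegular hreg hB]
    intro a _
    rw [← Set.Iio_insert]
    refine (mk_insert_le).trans_lt ?_
    exact add_lt_of_lt hreg.aleph0_le (mk_Iio_toType_ord_lt a)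
      (one_lt_aleph0.trans_le hreg.aleph0_le)
  rw [h1, mk_univ, mk_ord_toType] at h2
  exact lt_irrefl _ h2

theorem exists_chain {κ : Cardinal.{u}} {L : Type u} [LinearOrder L]
    (h : ∀ B : Set L, #B < κ → ∃ c, ∀ b ∈ B, b < c) :
    ∃ f : κ.ord.ToType → L, StrictMono f := by
  classical
  choose g hg using h
  have key : ∀ (w : κ.ord.ToType) (p : (v : κ.ord.ToType) → v < w → L),
      #(Set.range (fun v : Set.Iio w => p v.1 v.2)) < κ := fun w p =>
    mk_range_le.trans_lt (mk_Iio_toType_ord_lt w)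
  let f : κ.ord.ToType → L := (wellFounded_lt (α := κ.ord.ToType)).fix
    (fun w p => g _ (key w p))
  refine ⟨f, fun v w hvw => ?_⟩
  have : f w = g _ (key w (fun v _ => f v)) := WellFounded.fix_eq _ _ _
  rw [this]
  exact hg _ _ _ ⟨⟨v, hvw⟩, rfl⟩

theorem no_anti_lex {κ : Cardinal.{u}} (hreg : κ.IsRegular) {I A : Type u}
    [LinearOrder I] [WellFoundedLT I] [LinearOrder A] [WellFoundedLT A] (hI : #I < κ)
    (f : κ.ord.ToType → Lex (I → A)) : ¬ StrictAnti f := by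
  intro hf
  have key : ∀ i : I, ∃ w, ∀ v, w ≤ v → f v i = f w i := by
    intro i
    induction i using WellFoundedLT.induction with
    | ind i ih =>
      have : Nonempty κ.ord.ToType := ⟨(W_bdd hreg ∅ (by simpa using hreg.pos)).choose⟩
      choose! g hg using ih
      obtain ⟨w', hw'⟩ := W_bdd hreg (g '' (Set.Iio i))
        (mk_image_le.trans_lt ((mk_set_le _).trans_lt hI))
      have hne : ((fun v => f v i) '' Set.Ici w').Nonempty := ⟨_, w', Set.mem_Ici.2 le_rfl, rfl⟩
      obtain ⟨_, ⟨w, hw, rfl⟩, hmin⟩ := (wellFounded_lt (α := A)).has_min _ hne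
      refine ⟨w, fun v hv => ?_⟩
      rcases hv.eq_or_lt with rfl | hlt
      · rfl
      obtain ⟨k, hk1, hk2⟩ := hf hlt
      have hvi : ¬ f v i < f w i := hmin _ ⟨v, le_trans (Set.mem_Ici.1 hw) hv, rfl⟩
      have agree : ∀ j < i, f v j = f w j := by
        intro j hj
        have hjw : g j ≤ w' := (hw' _ ⟨j, hj, rfl⟩).le
        rw [hg j hj v (hjw.trans (le_trans hw hv)), hg j hj w (hjw.trans hw)]
      rcases lt_trichotomy k i with h | h | h
      · exact absurd (agree k h) hk2.ne
      · subst h; exact absurd hk2 hvi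
      · exact hk1 i h
  choose g hg using key
  obtain ⟨w, hw⟩ := W_bdd hreg (Set.range g) (mk_range_le.trans_lt hI)
  obtain ⟨v, hv⟩ := W_bdd hreg {w} (by
    rw [mk_singleton]; exact one_lt_aleph0.trans_le hreg.aleph0_le)
  have hwv : w < v := hv w rfl
  refine (hf hwv).ne ?_
  refine funext fun i => ?_
  have := (hw (g i) ⟨i, rfl⟩).le
  rw [hg i v (this.trans hwv.le), hg i w this]

theorem weakly_of_no_anti {κ : Cardinal.{u}} (hreg : κ.IsRegular) {P : Type u} [LinearOrder P]
    (h : ∀ f : κ.ord.ToType → P, ¬ StrictAnti f) : WeaklyKScattered κ P := by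
  rintro S ⟨_, hS⟩
  obtain ⟨f, hf⟩ := exists_chain (κ := κ) (L := (↥S)ᵒᵈ) (by
    intro B hB
    obtain ⟨c, _, hc⟩ := hS ∅ (OrderDual.toDual ⁻¹' B)
      (by simpa using hreg.pos) hB (by simp)
    exact ⟨OrderDual.toDual c, fun b hb => hc (OrderDual.ofDual b) hb⟩)
  exact h (fun w => (OrderDual.ofDual (f w)).1) fun a b hab => hf hab

theorem small_of_initial {κ : Cardinal.{u}} (hreg : κ.IsRegular) {L : Type u} [LinearOrder L]
    (hm : ∀ f : κ.ord.ToType → L, ¬ StrictMono f) (D : Set L)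
    (hD : ∀ b ∈ D, #{c | c ∈ D ∧ c ≤ b} < κ) : #D < κ := by
  by_contra hk
  obtain ⟨f, hf⟩ := exists_chain (κ := κ) (L := D) (by
    intro B hB
    by_contra! h
    apply hk
    have hsub : D ⊆ ⋃ b ∈ B, {c | c ∈ D ∧ c ≤ b.1} := by
      intro c hc
      obtain ⟨b, hb, hcb⟩ := h ⟨c, hc⟩
      simp only [Set.mem_iUnion]
      exact ⟨b, hb, hc, hcb⟩
    refine (mk_le_mk_of_subset hsub).trans_lt ?_
    rw [card_biUnion_lt_iff_forall_of_isRegular hreg hB]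
    intro b _
    exact hD b.1 b.2)
  exact hm (fun w => (f w).1) fun a b hab => hf hab

theorem union_lt {κ : Cardinal.{u}} (hreg : κ.IsRegular) {L : Type u} {A B : Set L}
    (hA : #A < κ) (hB : #B < κ) : #(A ∪ B : Set L) < κ :=
  (mk_union_le _ _).trans_lt (add_lt_of_lt hreg.aleph0_le hA hB)

theorem single_lt {κ : Cardinal.{u}} (hreg : κ.IsRegular) {L : Type u} (a : L) :
    #({a} : Set L) < κ := by
  rw [mk_singleton]; exact one_lt_aleph0.trans_le hreg.aleph0_le

def eqv {κ : Cardinal.{u}} (hreg : κ.IsRegular) (L : Type u) [LinearOrder L] : Setoid L where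
  r a b := #(Set.Ioo a b) < κ ∧ #(Set.Ioo b a) < κ
  iseqv := by
    have tr : ∀ a b c : L, #(Set.Ioo a b) < κ → #(Set.Ioo b c) < κ → #(Set.Ioo a c) < κ := by
      intro a b c h1 h2
      refine (mk_le_mk_of_subset (t := Set.Ioo a b ∪ ({b} ∪ Set.Ioo b c)) ?_).trans_lt
        (union_lt hreg h1 (union_lt hreg (single_lt hreg b) h2))
      rintro x ⟨hx1, hx2⟩
      rcases lt_trichotomy x b with h | h | h
      · exact Or.inl ⟨hx1, h⟩
      · exact Or.inr (Or.inl h)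
      · exact Or.inr (Or.inr ⟨h, hx2⟩)
    refine ⟨fun a => ?_, fun h => ⟨h.2, h.1⟩, fun h1 h2 => ⟨tr _ _ _ h1.1 h2.1, tr _ _ _ h2.2 h1.2⟩⟩
    simp [hreg.pos]

theorem class_lt {κ : Cardinal.{u}} (hreg : κ.IsRegular) {L : Type u} [LinearOrder L]
    (hm : ∀ f : κ.ord.ToType → L, ¬ StrictMono f) (ha : ∀ f : κ.ord.ToType → L, ¬ StrictAnti f)
    (a : L) : #{b | (eqv hreg L).r a b} < κ := by
  have h1 : #{b : L | a ≤ b ∧ #(Set.Ioo a b) < κ} < κ := by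
    apply small_of_initial hreg hm
    rintro b ⟨hb, hb2⟩
    refine (mk_le_mk_of_subset (t := Set.Ioo a b ∪ ({a} ∪ {b})) ?_).trans_lt
        (union_lt hreg hb2 (union_lt hreg (single_lt hreg a) (single_lt hreg b)))
    rintro x ⟨⟨hx, _⟩, hxb⟩
    rcases hx.eq_or_lt with h | h
    · exact Or.inr (Or.inl h.symm)
    rcases hxb.eq_or_lt with h' | h'
    · exact Or.inr (Or.inr h')
    exact Or.inl ⟨h, h'⟩
  have h2 : #{b : L | b ≤ a ∧ #(Set.Ioo b a) < κ} < κ := by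
    have hm' : ∀ f : κ.ord.ToType → Lᵒᵈ, ¬ StrictMono f := fun f hf =>
      ha (fun w => OrderDual.ofDual (f w)) fun x y h => hf h
    have key := @small_of_initial κ hreg Lᵒᵈ (OrderDual.instLinearOrder L) hm'
      (OrderDual.ofDual ⁻¹' {b : L | b ≤ a ∧ #(Set.Ioo b a) < κ})
    refine key ?_
    rintro (b : L) ⟨hb, hb2⟩
    refine (mk_le_mk_of_subset (α := L) (t := Set.Ioo (α := L) b a ∪ ({a} ∪ {b})) ?_).trans_lt
        (union_lt hreg hb2 (union_lt hreg (single_lt hreg a) (single_lt hreg b)))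
    rintro (x : L) ⟨⟨hx, _⟩, hxb⟩
    have hxb : (b : L) ≤ x := hxb
    rcases hx.eq_or_lt with h | h
    · exact Or.inr (Or.inl h)
    rcases hxb.eq_or_lt with h' | h'
    · exact Or.inr (Or.inr h'.symm)
    exact Or.inl ⟨h', h⟩
  refine (mk_le_mk_of_subset ?_).trans_lt (union_lt hreg h1 h2)
  rintro b ⟨hb1, hb2⟩
  rcases le_total a b with h | h
  · exact Or.inl ⟨h, hb1⟩
  · exact Or.inr ⟨h, hb2⟩

theorem exists_dense {κ : Cardinal.{u}} (hreg : κ.IsRegular) {L : Type u} [LinearOrder L]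
    (hm : ∀ f : κ.ord.ToType → L, ¬ StrictMono f) (ha : ∀ f : κ.ord.ToType → L, ¬ StrictAnti f)
    (hL : κ ≤ #L) : ¬ KScattered κ L := by
  intro hsc
  let s := eqv hreg L
  let ρ : L → L := fun x => (Quotient.mk s x).out
  have hρ : ∀ x, s.r (ρ x) x := fun x => Quotient.exact (Quotient.out_eq (Quotient.mk s x))
  have hρ2 : ∀ x y, s.r x y → ρ x = ρ y := fun x y h => by
    have : Quotient.mk s x = Quotient.mk s y := Quotient.sound h
    simp only [ρ, this]
  have hρ3 : ∀ x, ρ (ρ x) = ρ x := fun x => hρ2 _ _ (hρ x)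
  have hcl := class_lt hreg hm ha
  refine hsc (Set.range ρ) ⟨?_, ?_⟩
  · rw [Set.nontrivial_coe_sort]
    by_contra hnt
    rw [Set.not_nontrivial_iff] at hnt
    have hne : Nonempty L := by
      rw [← mk_ne_zero_iff]; exact (hreg.pos.trans_le hL).ne'
    obtain ⟨x0⟩ := hne
    refine (hL.trans ?_).not_gt (hcl (ρ x0))
    rw [← mk_univ]
    apply mk_le_mk_of_subset
    intro x _
    have : ρ x0 = ρ x := hnt ⟨x0, rfl⟩ ⟨x, rfl⟩
    show s.r (ρ x0) x
    rw [this]; exact hρ x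
  · rintro ⟨_, x, rfl⟩ ⟨_, y, rfl⟩ hxy
    have hxy : ρ x < ρ y := hxy
    by_contra hlt
    rw [not_le] at hlt
    have hbig : ¬ #(Set.Ioo (ρ x) (ρ y)) < κ := by
      intro h
      have : s.r (ρ x) (ρ y) := ⟨h, by simp [Set.Ioo_eq_empty_of_le hxy.le, hreg.pos]⟩
      have := hρ2 _ _ this
      rw [hρ3, hρ3] at this
      exact hxy.ne this
    apply hbig
    let T : Set L := Set.range ρ ∩ Set.Ioo (ρ x) (ρ y)
    have hT : #T < κ := by
      refine lt_of_le_of_lt ?_ hlt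
      refine mk_le_of_injective (f := fun t : T => ⟨⟨t.1, t.2.1⟩, t.2.2⟩) ?_
      intro a b h
      simpa [Subtype.ext_iff] using h
    have hU : #(⋃ t ∈ T, {b | s.r t b} : Set L) < κ := by
      rw [card_biUnion_lt_iff_forall_of_isRegular hreg hT]
      intro b _
      exact hcl b
    refine (mk_le_mk_of_subset ?_).trans_lt
      (union_lt hreg hU (union_lt hreg (hcl (ρ x)) (hcl (ρ y))))
    rintro z ⟨hz1, hz2⟩
    rcases lt_trichotomy (ρ z) (ρ x) with h | h | h
    · right; left
      have h1 : s.r (ρ z) (ρ x) := ⟨(mk_le_mk_of_subset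
        (Set.Ioo_subset_Ioo_right hz1.le)).trans_lt (hρ z).1,
        by simp [Set.Ioo_eq_empty_of_le h.le, hreg.pos]⟩
      exact s.trans (s.symm h1) (hρ z)
    · right; left
      show s.r (ρ x) z
      rw [← h]; exact hρ z
    rcases lt_trichotomy (ρ z) (ρ y) with h' | h' | h'
    · left
      simp only [Set.mem_iUnion]
      exact ⟨ρ z, ⟨⟨z, rfl⟩, h, h'⟩, hρ z⟩
    · right; right
      show s.r (ρ y) z
      rw [← h']; exact hρ z
    · right; right
      have h1 : s.r (ρ y) (ρ z) := ⟨(mk_le_mk_of_subset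
        (Set.Ioo_subset_Ioo_left hz2.le)).trans_lt (hρ z).2,
        by simp [Set.Ioo_eq_empty_of_le h'.le, hreg.pos]⟩
      exact s.trans h1 (hρ z)

theorem caseA (κ : Cardinal.{u}) (hreg : κ.IsRegular) (μ : Cardinal.{u}) (hμ : μ < κ)
    (h2 : κ ≤ 2 ^ μ) :
    ∃ (P : Type u) (_ : LinearOrder P), #P = κ ∧ WeaklyKScattered κ P ∧
      ¬ ∃ (ι : Type u) (F : ι → Set P), #ι < κ ∧ (∀ i, KScattered κ (F i)) ∧
        (⋃ i, F i) = Set.univ := by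
  let L := Lex (μ.ord.ToType → ULift.{u} Bool)
  have hI : #μ.ord.ToType < κ := by simpa using hμ
  have hL : κ ≤ #L := by
    have : #L = 2 ^ μ := by
      show #(μ.ord.ToType → ULift.{u} Bool) = _
      simp
    rw [this]; exact h2
  have : WellFoundedLT (ULift.{u} Bool) := Finite.to_wellFoundedLT
  have hanti : ∀ f : κ.ord.ToType → L, ¬ StrictAnti f := fun f => no_anti_lex hreg hI f
  have hmono : ∀ f : κ.ord.ToType → L, ¬ StrictMono f := by
    intro f hf
    refine hanti (fun w => toLex fun i => ULift.up (!(f w i).down)) ?_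
    intro v w hvw
    obtain ⟨i, h1, h2⟩ := hf hvw
    refine ⟨i, fun j hj => ?_, ?_⟩
    · have := h1 j hj
      show ULift.up (!(f w j).down) = ULift.up (!(f v j).down)
      rw [this]
    · show (!(f w i).down) < (!(f v i).down)
      have h2 : (f v i).down < (f w i).down := h2
      revert h2
      generalize (f v i).down = p
      generalize (f w i).down = q
      revert p q; decide
  obtain ⟨X, hX⟩ := le_mk_iff_exists_set.1 hL
  refine ⟨X, inferInstance, hX, ?_, ?_⟩
  · exact weakly_of_no_anti hreg fun f hf => hanti (fun w => (f w).1) fun a b h => hf h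
  · rintro ⟨ι, F, hι, hF, hU⟩
    have : #(⋃ i, F i) < κ := by
      rw [card_iUnion_lt_iff_forall_of_isRegular hreg hι]
      intro i
      by_contra hge
      exact exists_dense hreg (L := F i) (fun f hf => hmono (fun w => (f w).1.1) fun a b h => hf h)
        (fun f hf => hanti (fun w => (f w).1.1) fun a b h => hf h) (not_lt.1 hge) (hF i)
    rw [hU, mk_univ, hX] at this
    exact lt_irrefl _ this

theorem exists_mono {J N : Type u} [LinearOrder J] [WellFoundedLT J] [Preorder N] [Nonempty N]
    (Q : J → N → Prop)
    (h : ∀ j (p : Set.Iio j → N), Monotone p → ∃ n, (∀ k, p k ≤ n) ∧ Q j n) :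
    ∃ s : J → N, Monotone s ∧ ∀ j, Q j (s j) := by
  classical
  let s : J → N := (wellFounded_lt (α := J)).fix
    (fun j p => Classical.epsilon fun n => (∀ k : Set.Iio j, p k.1 k.2 ≤ n) ∧ Q j n)
  have hs : ∀ j, s j = Classical.epsilon fun n => (∀ k : Set.Iio j, s k.1 ≤ n) ∧ Q j n :=
    fun j => WellFounded.fix_eq _ _ _
  have key : ∀ j, (∀ k < j, s k ≤ s j) ∧ Q j (s j) := by
    intro j
    induction j using WellFoundedLT.induction with
    | ind j ih =>
      have hex := h j (fun k => s k.1) (by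
        intro a b hab
        rcases hab.eq_or_lt with h | h
        · rw [h]
        · exact (ih b.1 b.2).1 a.1 h)
      have := Classical.epsilon_spec hex
      rw [← hs] at this
      exact ⟨fun k hk => this.1 ⟨k, hk⟩, this.2⟩
  refine ⟨s, fun a b hab => ?_, fun j => (key j).2⟩
  rcases hab.eq_or_lt with h | h
  · rw [h]
  · exact (key b).1 a h

structure Node (J V : Type u) where
  l : J
  x : J → V

instance Node.pre (J V : Type u) [LinearOrder J] : Preorder (Node J V) where
  le n m := n.l ≤ m.l ∧ ∀ t < n.l, m.x t = n.x t
  le_refl n := ⟨le_rfl, fun _ _ => rfl⟩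
  le_trans a b c h1 h2 := ⟨h1.1.trans h2.1, fun t ht => by
    rw [h2.2 t (ht.trans_le h1.1), h1.2 t ht]⟩

theorem glue {J V K : Type u} [LinearOrder J] [LinearOrder K] [Nonempty V] (p : K → Node J V)
    (hp : Monotone p) : ∃ x : J → V, ∀ k, ∀ t < (p k).l, x t = (p k).x t := by
  have : ∀ t, ∃ v, ∀ k, t < (p k).l → v = (p k).x t := by
    intro t
    by_cases h : ∃ k, t < (p k).l
    · obtain ⟨k, hk⟩ := h
      refine ⟨(p k).x t, fun k' hk' => ?_⟩
      rcases le_total k k' with h | h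
      · exact ((hp h).2 t hk).symm
      · exact (hp h).2 t hk'
    · push Not at h
      exact ⟨Classical.arbitrary V, fun k hk => absurd hk (h k).not_gt⟩
  choose x hx using this
  exact ⟨x, fun k t ht => hx t k ht⟩

theorem baire {μ : Cardinal.{u}} (hreg : μ.IsRegular) {V : Type u} [Nonempty V]
    (G : μ.ord.ToType → Set (μ.ord.ToType → V))
    (hG : ∀ j (n : Node μ.ord.ToType V), ∃ m, n ≤ m ∧ ∀ y ∈ G j, ∃ t < m.l, y t ≠ m.x t) :
    ∃ x, ∀ j, x ∉ G j := by
  have : Nonempty μ.ord.ToType := ⟨(W_bdd hreg ∅ (by simpa using hreg.pos)).choose⟩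
  have : Nonempty (Node μ.ord.ToType V) :=
    ⟨⟨Classical.arbitrary _, fun _ => Classical.arbitrary _⟩⟩
  obtain ⟨s, hs, hQ⟩ := exists_mono
    (fun j (m : Node μ.ord.ToType V) => ∀ y ∈ G j, ∃ t < m.l, y t ≠ m.x t) (by
    intro j p hp
    obtain ⟨x, hx⟩ := glue p hp
    obtain ⟨l, hl⟩ := W_bdd hreg (Set.range fun k => (p k).l)
      (mk_range_le.trans_lt (mk_Iio_toType_ord_lt j))
    obtain ⟨m, hm, hm2⟩ := hG j ⟨l, x⟩
    exact ⟨m, fun k => le_trans ⟨(hl _ ⟨k, rfl⟩).le, hx k⟩ hm, hm2⟩)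
  obtain ⟨x, hx⟩ := glue s hs
  refine ⟨x, fun j hj => ?_⟩
  obtain ⟨t, ht, hne⟩ := hQ j x hj
  exact hne (hx j t ht)

theorem W_Ioi {κ : Cardinal.{u}} (hreg : κ.IsRegular) (a : κ.ord.ToType) :
    κ ≤ #(Set.Ioi a) := by
  by_contra! h
  have h1 : #(Set.Iio a ∪ ({a} ∪ Set.Ioi a) : Set κ.ord.ToType) < κ :=
    union_lt hreg (mk_Iio_toType_ord_lt a) (union_lt hreg (single_lt hreg a) h)
  have h2 : (Set.Iio a ∪ ({a} ∪ Set.Ioi a) : Set κ.ord.ToType) = Set.univ := by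
    ext x
    simpa using lt_trichotomy x a
  rw [h2, mk_univ, mk_ord_toType] at h1
  exact lt_irrefl _ h1

theorem scattered_nwd {κ μ : Cardinal.{u}} (hreg : κ.IsRegular) (hμ : μ.IsRegular)
    {P : Type u} [LinearOrder P] (e : Lex (μ.ord.ToType → κ.ord.ToType) → P) (he : StrictMono e)
    (F : Set P) (hF : KScattered κ F) (n : Node μ.ord.ToType κ.ord.ToType) :
    ∃ m, n ≤ m ∧ ∀ y, e (toLex y) ∈ F → ∃ t < m.l, y t ≠ m.x t := by
  classical
  by_contra! hcon
  choose d hd1 hd2 using hcon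
  have up : ∀ j : μ.ord.ToType, ∃ k, j < k := fun j => by
    obtain ⟨k, hk⟩ := W_bdd hμ {j} (single_lt hμ j)
    exact ⟨k, hk j rfl⟩
  have upW : ∀ j : κ.ord.ToType, ∃ k, j < k := fun j => by
    obtain ⟨k, hk⟩ := W_bdd hreg {j} (single_lt hreg j)
    exact ⟨k, hk j rfl⟩
  let S : Set F := {z | ∃ y : μ.ord.ToType → κ.ord.ToType, (∀ t < n.l, y t = n.x t) ∧
    e (toLex y) = z.1}
  -- the elements through modified nodes
  have main : ∀ (y : μ.ord.ToType → κ.ord.ToType) (k : μ.ord.ToType) (v : κ.ord.ToType),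
      (∀ t < n.l, y t = n.x t) → n.l ≤ k →
      ∃ z : μ.ord.ToType → κ.ord.ToType, (∀ t < n.l, z t = n.x t) ∧ (∀ t < k, z t = y t) ∧
        z k = v ∧ e (toLex z) ∈ F := by
    intro y k v hy hk
    obtain ⟨k', hk'⟩ := up k
    let m : Node μ.ord.ToType κ.ord.ToType := ⟨k', Function.update y k v⟩
    have hm2 : ∀ t < k, m.x t = y t := fun t ht => by simp [m, Function.update, ht.ne]
    have hnm : n ≤ m := ⟨hk.trans hk'.le, fun t ht => by
      rw [hm2 t (ht.trans_le hk), hy t ht]⟩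
    have hd : ∀ t < k', d m hnm t = m.x t := hd2 m hnm
    refine ⟨d m hnm, fun t ht => ?_, fun t ht => ?_, ?_, hd1 m hnm⟩
    · rw [hd t (ht.trans_le (hk.trans hk'.le)), hm2 t (ht.trans_le hk), hy t ht]
    · rw [hd t (ht.trans hk'), hm2 t ht]
    · rw [hd k hk']; simp [m]
  refine hF S ⟨?_, ?_⟩
  · obtain ⟨v, hv⟩ := upW (n.x n.l)
    obtain ⟨z1, h1, -, h1v, h1F⟩ := main n.x n.l (n.x n.l) (fun _ _ => rfl) le_rfl
    obtain ⟨z2, h2, -, h2v, h2F⟩ := main n.x n.l v (fun _ _ => rfl) le_rfl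
    refine ⟨⟨⟨_, h1F⟩, z1, h1, rfl⟩, ⟨⟨_, h2F⟩, z2, h2, rfl⟩, fun h => ?_⟩
    have h3 : e (toLex z1) = e (toLex z2) := congrArg (fun q : S => q.1.1) h
    have h4 : z1 = z2 := toLex_inj.1 (he.injective h3)
    rw [h4, h2v] at h1v
    exact hv.ne' h1v
  · rintro ⟨⟨a, haF⟩, y, hy, hya⟩ ⟨⟨b, hbF⟩, y', hy', hyb⟩ hab
    have hya : e (toLex y) = a := hya
    have hyb : e (toLex y') = b := hyb
    subst hya hyb
    have hlt : toLex y < toLex y' := he.lt_iff_lt.1 hab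
    obtain ⟨k, hk1, hk2⟩ := hlt
    have hk1 : ∀ t < k, y t = y' t := hk1
    have hk2 : y k < y' k := hk2
    have hnk : n.l ≤ k := by
      by_contra! h
      rw [hy k h, hy' k h] at hk2
      exact lt_irrefl _ hk2
    obtain ⟨k', hk'⟩ := up k
    choose z hz1 hz2 hz3 hz4 using fun v => main y k' v hy (hnk.trans hk'.le)
    refine (W_Ioi hreg (y k')).trans ?_
    refine mk_le_of_injective (f := fun v : Set.Ioi (y k') =>
      ⟨⟨⟨_, hz4 v.1⟩, z v.1, hz1 v.1, rfl⟩, ?_, ?_⟩) ?_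
    · refine he (a := toLex y) (b := toLex (z v.1)) ⟨k', fun t ht => (hz2 v.1 t ht).symm, ?_⟩
      show y k' < z v.1 k'
      rw [hz3]; exact v.2
    · refine he (a := toLex (z v.1)) (b := toLex y') ⟨k, fun t ht => ?_, ?_⟩
      · exact (hz2 v.1 t (ht.trans hk')).trans (hk1 t ht)
      · show z v.1 k < y' k
        rw [hz2 v.1 k hk']; exact hk2
    · intro v v' h
      have h3 : e (toLex (z v.1)) = e (toLex (z v'.1)) := congrArg (fun q => q.1.1.1) h
      have h4 : z v.1 = z v'.1 := toLex_inj.1 (he.injective h3)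
      apply Subtype.ext
      rw [← hz3 v.1, h4, hz3]

theorem power_eq {κ : Cardinal.{u}} (hreg : κ.IsRegular) (hsl : ∀ μ < κ, 2 ^ μ < κ)
    {J : Type u} (hJ : #J < κ) : #(J → κ.ord.ToType) ≤ κ := by
  classical
  have hb : ∀ f : J → κ.ord.ToType, ∃ w, ∀ j, f j < w := fun f => by
    obtain ⟨w, hw⟩ := W_bdd hreg (Set.range f) (mk_range_le.trans_lt hJ)
    exact ⟨w, fun j => hw _ ⟨j, rfl⟩⟩
  choose B hB using hb
  have h1 : #(J → κ.ord.ToType) ≤ #(Σ w : κ.ord.ToType, (J → Set.Iio w)) := by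
    refine mk_le_of_injective (f := fun f => ⟨B f, fun j => ⟨f j, hB f j⟩⟩) ?_
    intro f g h
    have h2 := congrArg
      (fun q : (Σ w : κ.ord.ToType, (J → Set.Iio w)) => fun j => (q.2 j).1) h
    exact h2
  refine h1.trans ?_
  rw [mk_sigma]
  refine (sum_le_sum (fun w : κ.ord.ToType => #(J → Set.Iio w)) (fun _ => κ) fun w => ?_).trans ?_
  · have h3 : #(J → Set.Iio w) = #(Set.Iio w) ^ #J := by simp
    rw [h3]
    have hw := mk_Iio_toType_ord_lt w
    calc #(Set.Iio w) ^ #J ≤ (2 ^ #(Set.Iio w)) ^ #J := power_le_power_right (cantor _).le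
      _ = 2 ^ (#(Set.Iio w) * #J) := by rw [← power_mul]
      _ ≤ κ := (hsl _ (mul_lt_of_lt hreg.aleph0_le hw hJ)).le
  · simp [mul_eq_self hreg.aleph0_le]

theorem no_anti_sigma {κ : Cardinal.{u}} (hreg : κ.IsRegular) {I : Type u} [LinearOrder I]
    [WellFoundedLT I] {A : I → Type u} [∀ i, LinearOrder (A i)]
    (h : ∀ i, ∀ f : κ.ord.ToType → A i, ¬ StrictAnti f)
    (hshift : ∀ w0 : κ.ord.ToType, ∃ g : κ.ord.ToType → κ.ord.ToType, StrictMono g ∧ ∀ w, w0 ≤ g w)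
    (f : κ.ord.ToType → Σₗ i, A i) : ¬ StrictAnti f := by
  intro hf
  have hne : (Set.range fun w => (ofLex (f w)).1).Nonempty :=
    ⟨_, (W_bdd hreg ∅ (by simpa using hreg.pos)).choose, rfl⟩
  obtain ⟨_, ⟨w, rfl⟩, hmin⟩ := (wellFounded_lt (α := I)).has_min _ hne
  have heq : ∀ v, w ≤ v → (ofLex (f v)).1 = (ofLex (f w)).1 := by
    intro v hv
    rcases hv.eq_or_lt with rfl | hlt
    · rfl
    have h1 := hf hlt
    rw [Sigma.Lex.lt_def] at h1
    rcases h1 with h1 | ⟨h1, _⟩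
    · exact absurd h1 (hmin _ ⟨v, rfl⟩)
    · exact h1
  obtain ⟨g, hg, hgw⟩ := hshift w
  set i := (ofLex (f w)).1 with hi
  have hex : ∀ v, ∃ a : A i, f (g v) = toLex ⟨i, a⟩ := by
    intro v
    have := heq (g v) (hgw v)
    generalize f (g v) = q at this
    obtain ⟨j, a⟩ := q
    change j = i at this
    subst this
    exact ⟨a, rfl⟩
  choose a ha using hex
  refine h i a fun v v' hv => ?_
  have h1 := hf (hg hv)
  rw [ha, ha, Sigma.Lex.lt_def] at h1
  rcases h1 with h1 | ⟨_, h1⟩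
  · exact absurd h1 (lt_irrefl _)
  · exact h1

theorem W_shift {κ : Cardinal.{u}} (hreg : κ.IsRegular) (w0 : κ.ord.ToType) :
    ∃ g : κ.ord.ToType → κ.ord.ToType, StrictMono g ∧ ∀ w, w0 ≤ g w := by
  obtain ⟨f, hf⟩ := exists_chain (κ := κ) (L := Set.Ici w0) (by
    intro B hB
    obtain ⟨c, hc⟩ := W_bdd hreg (Subtype.val '' B ∪ {w0})
      (union_lt hreg (mk_image_le.trans_lt hB) (single_lt hreg w0))
    exact ⟨⟨c, (hc w0 (Or.inr rfl)).le⟩, fun b hb => hc b.1 (Or.inl ⟨b, hb, rfl⟩)⟩)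
  exact ⟨fun w => (f w).1, fun a b h => hf h, fun w => (f w).2⟩

theorem caseB (κ : Cardinal.{u}) (hreg : κ.IsRegular) (hunc : ℵ₀ < κ)
    (hsl : ∀ μ < κ, 2 ^ μ < κ) :
    ∃ (P : Type u) (_ : LinearOrder P), #P = κ ∧ WeaklyKScattered κ P ∧
      ¬ ∃ (ι : Type u) (F : ι → Set P), #ι < κ ∧ (∀ i, KScattered κ (F i)) ∧
        (⋃ i, F i) = Set.univ := by
  let lam : κ.ord.ToType → Cardinal.{u} := fun w => Order.succ (max ℵ₀ #(Set.Iio w))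
  have lreg : ∀ w, (lam w).IsRegular := fun w => isRegular_succ (le_max_left _ _)
  have llt : ∀ w, lam w < κ := fun w =>
    (Order.succ_le_of_lt (cantor _)).trans_lt (hsl _ (max_lt hunc (mk_Iio_toType_ord_lt w)))
  have Jlt : ∀ w, #(lam w).ord.ToType < κ := fun w => by simpa using llt w
  let A : κ.ord.ToType → Type u := fun w => Lex ((lam w).ord.ToType → κ.ord.ToType)
  have hA : ∀ w, #(A w) ≤ κ := fun w => power_eq hreg hsl (Jlt w)
  have hWne : Nonempty κ.ord.ToType := ⟨(W_bdd hreg ∅ (by simpa using hreg.pos)).choose⟩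
  refine ⟨Σₗ w, A w, inferInstance, ?_, ?_, ?_⟩
  · apply le_antisymm
    · show #(Σ w, A w) ≤ κ
      rw [mk_sigma]
      refine (sum_le_sum _ (fun _ => κ) hA).trans ?_
      simp [mul_eq_self hreg.aleph0_le]
    · conv_lhs => rw [← mk_ord_toType κ]
      refine mk_le_of_injective (f := fun w => (toLex ⟨w, toLex fun _ => w⟩ : Σₗ w, A w)) ?_
      intro v w h
      exact congrArg (fun q : Σₗ w, A w => (ofLex q).1) h
  · exact weakly_of_no_anti hreg
      (no_anti_sigma hreg (fun w f => no_anti_lex hreg (Jlt w) f) (W_shift hreg))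
  · rintro ⟨ι, F, hι, hF, hU⟩
    have h1 : #ι ≤ #κ.ord.ToType := by rw [mk_ord_toType]; exact hι.le
    obtain ⟨φ⟩ := h1
    obtain ⟨w, hw⟩ := W_bdd hreg (Set.range φ) (mk_range_le.trans_lt hι)
    have h2 : #ι ≤ #(lam w).ord.ToType := by
      rw [mk_ord_toType]
      refine le_trans ?_ ((le_max_right _ _).trans (Order.le_succ _))
      refine mk_le_of_injective (f := fun i => ⟨φ i, hw _ ⟨i, rfl⟩⟩) ?_
      intro i j h
      exact φ.injective (congrArg Subtype.val h)
    obtain ⟨ψ⟩ := h2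
    have hιne : Nonempty ι := by
      obtain ⟨v⟩ := hWne
      have : (toLex ⟨v, toLex fun _ => v⟩ : Σₗ w, A w) ∈ ⋃ i, F i := by rw [hU]; trivial
      obtain ⟨i, -⟩ := Set.mem_iUnion.1 this
      exact ⟨i⟩
    let r := Function.invFun ψ
    have hr : ∀ i, r (ψ i) = i := Function.leftInverse_invFun ψ.injective
    let e : Lex ((lam w).ord.ToType → κ.ord.ToType) → Σₗ w, A w := fun x => toLex ⟨w, x⟩
    have he : StrictMono e := fun x y h => (Sigma.Lex.lt_def).2 (Or.inr ⟨rfl, h⟩)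
    obtain ⟨x, hx⟩ := baire (lreg w) (V := κ.ord.ToType)
      (fun j => {y | e (toLex y) ∈ F (r j)})
      (fun j n => scattered_nwd hreg (lreg w) e he (F (r j)) (hF _) n)
    have : e (toLex x) ∈ ⋃ i, F i := by rw [hU]; trivial
    obtain ⟨i, hi⟩ := Set.mem_iUnion.1 this
    apply hx (ψ i)
    show e (toLex x) ∈ F (r (ψ i))
    rw [hr]; exact hi

/-- Suppose `κ` is a regular uncountable cardinal.  Then there is a linear
order of cardinality `κ` that is weakly `κ`-scattered but not `(κ, κ)`-scattered (i.e.,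
not a union of fewer than `κ` many `κ`-scattered suborders). -/
theorem stmt16 (κ : Cardinal.{u}) (hreg : κ.IsRegular) (hunc : ℵ₀ < κ) :
    ∃ (P : Type u) (_ : LinearOrder P), #P = κ ∧ WeaklyKScattered κ P ∧
      ¬ ∃ (ι : Type u) (F : ι → Set P), #ι < κ ∧ (∀ i, KScattered κ (F i)) ∧
        (⋃ i, F i) = Set.univ := by
  by_cases h : ∃ μ < κ, κ ≤ 2 ^ μ
  · obtain ⟨μ, h1, h2⟩ := h
    exact caseA κ hreg μ h1 h2
  · push Not at h
    exact caseB κ hreg hunc h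
end

section
/- Suppose κ is an infinite cardinal with κ^{<κ} = κ, φ is a κ-scattered linear order type, and ν is a cardinal. Then there is a κ-scattered linear order type ψ such that ψ → [φ]¹_{ν, κ}. -/
open Cardinal

universe u

theorem kIio {c : Cardinal.{u}} (i : c.ord.ToType) : #(Set.Iio i) < c := by
  have := Cardinal.mk_Iio_lt (α := c.ord.ToType) i (by simp)
  simpa using this

/-! ### Part 1: the tree partition theorem -/

inductive SEmb {L M : Type u} [LinearOrder L] (F : List L → M) (c : ℕ → M) :
    Ordinal.{u} → List L → Prop
  | mk (a : Ordinal.{u}) (s : List L) (g : Ordinal.{u} → L)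
      (hm : StrictMonoOn g (Set.Iio a))
      (hl : ∀ b < a, ∀ x ∈ s, g b < x)
      (hc : ∀ b < a, F (g b :: s) = c s.length)
      (hr : ∀ b < a, SEmb F c b (g b :: s)) : SEmb F c a s

section tree
variable {L M : Type u} [LinearOrder L] (F : List L → M) (α : Ordinal.{u})

noncomputable def srk (c : ℕ → M) (s : List L) : Ordinal.{u} :=
  sInf {a | ¬ SEmb F c a s ∨ a = α}

theorem srk_le (c : ℕ → M) (s : List L) : srk F α c s ≤ α :=
  csInf_le' (Or.inr rfl)

theorem srk_mem (c : ℕ → M) (s : List L) :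
    ¬ SEmb F c (srk F α c s) s ∨ srk F α c s = α :=
  csInf_mem (s := {a | ¬ SEmb F c a s ∨ a = α}) ⟨α, Or.inr rfl⟩

theorem semb_of_lt (c : ℕ → M) (s : List L) (b : Ordinal.{u}) (hb : b < srk F α c s) :
    SEmb F c b s := by
  by_contra h
  exact (csInf_le' (s := {a | ¬ SEmb F c a s ∨ a = α}) (Or.inl h)).not_gt hb

def SCompat (c : ℕ → M) : List L → Prop
  | [] => True
  | x :: s => F (x :: s) = c s.length ∧ SCompat c s

def SGood : List L → Prop
  | [] => True
  | x :: s => (∀ y ∈ s, x < y) ∧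
      (∀ c, SCompat F c (x :: s) → srk F α c (x :: s) < srk F α c s) ∧ SGood s

theorem sgood_genuine (h0 : ∀ c, ¬ SEmb F c α []) (c : ℕ → M) (s : List L)
    (hg : SGood F α s) (hc : SCompat F c s) : ¬ SEmb F c (srk F α c s) s := by
  rcases srk_mem F α c s with h | h
  · exact h
  · cases s with
    | nil => rw [h]; exact h0 c
    | cons x s =>
      have := hg.2.1 c hc
      rw [h] at this
      exact absurd this (srk_le F α c s).not_gt

/-- bad extensions for a fixed color sequence -/
def SBad (c : ℕ → M) (s : List L) : Set L :=
  {x | (∀ y ∈ s, x < y) ∧ SCompat F c (x :: s) ∧ srk F α c s ≤ srk F α c (x :: s)}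

theorem sbad_card [WellFoundedLT L] [Nonempty L] (c : ℕ → M) (s : List L)
    (h : SCompat F c s → ¬ SEmb F c (srk F α c s) s) : #(SBad F α c s) ≤ α.card := by
  by_cases hc : SCompat F c s
  swap
  · have : SBad F α c s = ∅ := by
      ext x; simp only [SBad, Set.mem_ofPred_eq, Set.mem_empty_iff_false, iff_false]
      rintro ⟨-, h2, -⟩
      exact hc h2.2
    rw [this]; simp
  specialize h hc
  set B := SBad F α c s with hB
  set r := srk F α c s with hr
  by_cases hlt : r ≤ Ordinal.type (α := B) (· < ·)
  · exfalso
    apply h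
    classical
    let g : Ordinal.{u} → L := fun b =>
      if hb : b < Ordinal.type (α := B) (· < ·) then
        ((Ordinal.enum (α := B) (· < ·) ⟨b, hb⟩ : B) : L) else Classical.arbitrary L
    have hgB : ∀ b < r, g b ∈ B := by
      intro b hb
      simp only [g, dif_pos (hb.trans_le hlt)]
      exact Subtype.coe_prop _
    refine SEmb.mk _ _ g ?_ ?_ ?_ ?_
    · intro a ha b hb hab
      have ha' : a < Ordinal.type (α := B) (· < ·) := lt_of_lt_of_le ha hlt
      have hb' : b < Ordinal.type (α := B) (· < ·) := lt_of_lt_of_le hb hlt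
      simp only [g, dif_pos ha', dif_pos hb']
      have := (Ordinal.enum_lt_enum (α := B) (r := (· < ·)) (o₁ := ⟨a, ha'⟩)
        (o₂ := ⟨b, hb'⟩)).2 hab
      exact this
    · intro b hb
      exact (hgB b hb).1
    · intro b hb
      exact (hgB b hb).2.1.1
    · intro b hb
      exact semb_of_lt F α c _ b (hb.trans_le (hgB b hb).2.2)
  · rw [not_le] at hlt
    have := Ordinal.card_le_card hlt.le
    rw [Ordinal.card_type] at this
    exact this.trans (Ordinal.card_le_card (srk_le F α c s))


noncomputable def sty (s : List L) : M × ((ℕ → M) → Shrink.{u} (Set.Iic α)) :=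
  (F s, fun c => equivShrink _ ⟨srk F α c s, srk_le F α c s⟩)

noncomputable def styl : List L → List (M × ((ℕ → M) → Shrink.{u} (Set.Iic α)))
  | [] => []
  | x :: s => sty F α (x :: s) :: styl s

theorem styl_length (s : List L) : (styl F α s).length = s.length := by
  induction s with
  | nil => rfl
  | cons x s ih => simp [styl, ih]

end tree

theorem tree_partition (M : Type u) (α : Ordinal.{u}) :
    ∃ (L : Type u) (_ : LinearOrder L) (_ : WellFoundedLT L) (_ : Nonempty L),
      ∀ F : List L → M, ∃ c : ℕ → M, SEmb F c α [] := by
  classical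
  set W := M × ((ℕ → M) → Shrink.{u} (Set.Iic α)) with hW
  set μ : Cardinal.{u} := max ℵ₀ (max #W (#(ℕ → M) * α.card)) with hμ
  have hμ0 : ℵ₀ ≤ μ := le_max_left _ _
  have hreg : (Order.succ μ).IsRegular := isRegular_succ hμ0
  set Θ := (Order.succ μ).ord.ToType with hΘ
  have hΘc : #Θ = Order.succ μ := by simp [hΘ]
  have hIio : ∀ i : Θ, #(Set.Iio i) < Order.succ μ := fun i => kIio i
  have hΘinf : ℵ₀ ≤ #Θ := by rw [hΘc]; exact hμ0.trans (Order.le_succ _)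
  have : Infinite Θ := Cardinal.infinite_iff.2 hΘinf
  have hno : ∀ i : Θ, ∃ j, i < j := by
    intro i
    by_contra h
    push Not at h
    have h1 : #(Set.Iic i) < Order.succ μ := by
      rw [← Set.Iio_insert]
      refine (mk_insert_le).trans_lt ?_
      exact add_lt_of_lt hreg.aleph0_le (hIio i) (one_lt_aleph0.trans_le hreg.aleph0_le)
    have h2 : Set.Iic i = Set.univ := by ext j; simp [h j]
    rw [h2, mk_univ, hΘc] at h1
    exact lt_irrefl _ h1
  refine ⟨Θ ×ₗ Θ, inferInstance, inferInstance, inferInstance, fun F => ?_⟩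
  by_contra hcon
  push Not at hcon
  let Pr : List W → Prop := fun t => ∀ θ : Θ, ∃ s : List (Θ ×ₗ Θ),
    SGood F α s ∧ styl F α s = t ∧ ∀ x ∈ s, θ ≤ (ofLex x).1
  have hP0 : Pr [] := fun θ => ⟨[], trivial, rfl, by simp⟩
  have hstep : ∀ t, Pr t → ∃ w, Pr (w :: t) := by
    intro t ht
    have h1 : ∀ θ : Θ, ∃ w : W, ∃ s : List (Θ ×ₗ Θ),
        SGood F α s ∧ styl F α s = w :: t ∧ ∀ x ∈ s, θ ≤ (ofLex x).1 := by
      intro θ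
      obtain ⟨θ', hθ'⟩ := hno θ
      obtain ⟨s, hs, hst, hsx⟩ := ht θ'
      have hlt : ∀ k : Θ, ∀ y ∈ s, (toLex (θ, k) : Θ ×ₗ Θ) < y := by
        intro k y hy
        rw [Prod.Lex.lt_iff]
        exact Or.inl (hθ'.trans_le (hsx y hy))
      have hbad : #(⋃ c, SBad F α c s : Set (Θ ×ₗ Θ)) ≤ μ := by
        refine (mk_iUnion_le_sum_mk).trans ?_
        refine (Cardinal.sum_le_sum _ (fun _ => α.card) (fun c =>
          sbad_card F α c s (sgood_genuine F α hcon c s hs))).trans ?_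
        rw [Cardinal.sum_const']
        exact (le_max_right _ _).trans (le_max_right _ _)
      obtain ⟨k, hk⟩ : ∃ k : Θ, (toLex (θ, k) : Θ ×ₗ Θ) ∉ ⋃ c, SBad F α c s := by
        by_contra h
        push Not at h
        have : #Θ ≤ #(⋃ c, SBad F α c s : Set (Θ ×ₗ Θ)) :=
          mk_le_of_injective (f := fun k => ⟨toLex (θ, k), h k⟩) (by
            intro a b hab
            simpa using hab)
        rw [hΘc] at this
        exact (Order.lt_succ μ).not_ge (this.trans hbad)
      refine ⟨sty F α (toLex (θ, k) :: s), toLex (θ, k) :: s, ⟨hlt k, ?_, hs⟩, ?_, ?_⟩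
      · intro c hc
        by_contra hn
        exact hk (Set.mem_iUnion.2 ⟨c, hlt k, hc, not_lt.1 hn⟩)
      · simp [styl, hst]
      · intro x hx
        rcases List.mem_cons.1 hx with rfl | hx
        · exact le_rfl
        · exact hθ'.le.trans (hsx x hx)
    choose w hw using h1
    obtain ⟨w0, hw0⟩ := infinite_pigeonhole_card w (#Θ) le_rfl hΘinf (by
      rw [hΘc, hreg.cof_ord]
      exact Order.lt_succ_of_le ((le_max_left _ _).trans (le_max_right _ _)))
    refine ⟨w0, fun θ => ?_⟩
    obtain ⟨θ', h1, h2⟩ : ∃ θ', θ ≤ θ' ∧ w θ' = w0 := by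
      by_contra h
      push Not at h
      have : w ⁻¹' {w0} ⊆ Set.Iio θ := by
        intro x hx
        by_contra hx'
        exact h x (not_lt.1 hx') hx
      have := (hw0.trans (mk_le_mk_of_subset this)).trans_lt (hIio θ)
      rw [hΘc] at this
      exact lt_irrefl _ this
    obtain ⟨s, hs1, hs2, hs3⟩ := hw θ'
    exact ⟨s, hs1, by rw [hs2, h2], fun x hx => h1.trans (hs3 x hx)⟩
  have : Nonempty W := ⟨(hstep [] hP0).choose⟩
  choose! nx hnx using hstep
  let t : ℕ → List W := fun n => Nat.rec [] (fun _ t => nx t :: t) n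
  have htS : ∀ n, t (n+1) = nx (t n) :: t n := fun n => rfl
  have hPt : ∀ n, Pr (t n) := by
    intro n
    induction n with
    | zero => exact hP0
    | succ n ih => rw [htS]; exact hnx _ ih
  have hlen : ∀ n, (t n).length = n := by
    intro n
    induction n with
    | zero => rfl
    | succ n ih => rw [htS]; simp [ih]
  let c : ℕ → M := fun n => (nx (t n)).1
  have hcompat : ∀ n (s : List (Θ ×ₗ Θ)), styl F α s = t n → SCompat F c s := by
    intro n
    induction n with
    | zero =>
      intro s hs
      cases s with
      | nil => trivial
      | cons x s => simp [styl, t] at hs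
    | succ n ih =>
      intro s hs
      cases s with
      | nil => trivial
      | cons x s =>
        rw [htS] at hs
        simp only [styl, List.cons.injEq] at hs
        refine ⟨?_, ih s hs.2⟩
        have : s.length = n := by rw [← styl_length F α, hs.2, hlen]
        rw [this]
        simp only [c, ← hs.1, sty]
  have hdesc : ∀ n, ((equivShrink _).symm ((nx (t (n+1))).2 c)).1 <
      ((equivShrink _).symm ((nx (t n)).2 c)).1 := by
    intro n
    obtain ⟨s, hs, hst, -⟩ := hPt (n+2) (Classical.arbitrary Θ)
    have hc := hcompat (n+2) s hst
    rcases s with _ | ⟨x, _ | ⟨y, s⟩⟩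
    · simp [styl, t] at hst
    · simp [styl, t] at hst
    · rw [show t (n + 2) = nx (t (n + 1)) :: nx (t n) :: t n from rfl] at hst
      simp only [styl, List.cons.injEq] at hst
      have := hs.2.1 c hc
      rw [← hst.1, ← hst.2.1]
      simpa [sty] using this
  exact (RelEmbedding.natGT (r := ((· < ·) : Ordinal.{u} → Ordinal.{u} → Prop)) _ hdesc).not_wellFounded
    Ordinal.lt_wf


/-! ### Part 2: iterated condensation -/

inductive KE (κ : Cardinal.{u}) {P : Type u} [LinearOrder P] : Ordinal.{u} → P → P → Prop
  | refl (a : Ordinal.{u}) (x : P) : KE κ a x x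
  | step (a b : Ordinal.{u}) (hb : b < a) (x y : P) (t : P → P)
      (ht : #(t '' Set.uIcc x y) < κ) (h : ∀ z ∈ Set.uIcc x y, KE κ b z (t z)) : KE κ a x y

def KN (κ : Cardinal.{u}) {P : Type u} [LinearOrder P] (b : Ordinal.{u}) (x y : P) : Prop :=
  ∃ t : P → P, #(t '' Set.uIcc x y) < κ ∧ ∀ z ∈ Set.uIcc x y, KE κ b z (t z)

section KE
variable {κ : Cardinal.{u}} {P : Type u} [LinearOrder P]

theorem KE_iff {a : Ordinal.{u}} {x y : P} : KE κ a x y ↔ x = y ∨ ∃ b < a, KN κ b x y := by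
  constructor
  · rintro (⟨a, x⟩ | ⟨a, b, hb, x, y, t, ht, h⟩)
    · exact Or.inl rfl
    · exact Or.inr ⟨b, hb, t, ht, h⟩
  · rintro (rfl | ⟨b, hb, t, ht, h⟩)
    · exact KE.refl _ _
    · exact KE.step _ _ hb _ _ t ht h

theorem KE.mono {a a' : Ordinal.{u}} (h : a ≤ a') {x y : P} (hx : KE κ a x y) : KE κ a' x y := by
  rw [KE_iff] at *
  exact hx.imp_right fun ⟨b, hb, h'⟩ => ⟨b, hb.trans_le h, h'⟩

theorem KN.mono {a a' : Ordinal.{u}} (h : a ≤ a') {x y : P} (hx : KN κ a x y) : KN κ a' x y := by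
  obtain ⟨t, ht, h'⟩ := hx
  exact ⟨t, ht, fun z hz => (h' z hz).mono h⟩

theorem KN.sub {a : Ordinal.{u}} {x y x' y' : P} (hx : KN κ a x y)
    (h : Set.uIcc x' y' ⊆ Set.uIcc x y) : KN κ a x' y' := by
  obtain ⟨t, ht, h'⟩ := hx
  exact ⟨t, (mk_le_mk_of_subset (Set.image_mono h)).trans_lt ht, fun z hz => h' z (h hz)⟩

theorem KN.symm {a : Ordinal.{u}} {x y : P} (hx : KN κ a x y) : KN κ a y x :=
  hx.sub (by rw [Set.uIcc_comm])

theorem KE.symm {a : Ordinal.{u}} {x y : P} (hx : KE κ a x y) : KE κ a y x := by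
  rw [KE_iff] at *
  rcases hx with h | ⟨b, hb, h⟩
  · exact Or.inl h.symm
  · exact Or.inr ⟨b, hb, h.symm⟩

theorem KE.sub {a : Ordinal.{u}} {x y z : P} (hx : KE κ a x y) (hz : z ∈ Set.uIcc x y) :
    KE κ a x z := by
  rw [KE_iff] at *
  rcases hx with rfl | ⟨b, hb, h⟩
  · left; simpa [eq_comm] using hz
  · exact Or.inr ⟨b, hb, h.sub (Set.uIcc_subset_uIcc Set.left_mem_uIcc hz)⟩

theorem KN.trans (hκ : ℵ₀ ≤ κ) {a : Ordinal.{u}} {x y z : P} (h1 : KN κ a x y)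
    (h2 : KN κ a y z) : KN κ a x z := by
  classical
  obtain ⟨t, ht, h⟩ := h1
  obtain ⟨t', ht', h'⟩ := h2
  refine ⟨fun w => if w ∈ Set.uIcc x y then t w else t' w, ?_, ?_⟩
  · refine (mk_le_mk_of_subset (t := t '' Set.uIcc x y ∪ t' '' Set.uIcc y z) ?_).trans_lt
      ((mk_union_le _ _).trans_lt (add_lt_of_lt hκ ht ht'))
    rintro _ ⟨w, hw, rfl⟩
    by_cases hwx : w ∈ Set.uIcc x y
    · left; exact ⟨w, hwx, by simp [hwx]⟩
    · right; exact ⟨w, (Set.uIcc_subset_uIcc_union_uIcc hw).resolve_left hwx, by simp [hwx]⟩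
  · intro w hw
    by_cases hwx : w ∈ Set.uIcc x y
    · simp only [hwx, if_true]; exact h w hwx
    · simp only [hwx, if_false]
      exact h' w ((Set.uIcc_subset_uIcc_union_uIcc hw).resolve_left hwx)

theorem KE.trans (hκ : ℵ₀ ≤ κ) {a : Ordinal.{u}} {x y z : P} (h1 : KE κ a x y)
    (h2 : KE κ a y z) : KE κ a x z := by
  rw [KE_iff] at h1 h2
  rcases h1 with rfl | ⟨b, hb, h⟩
  · exact KE_iff.2 h2
  rcases h2 with rfl | ⟨b', hb', h'⟩
  · exact KE_iff.2 (Or.inr ⟨b, hb, h⟩)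
  exact KE_iff.2 (Or.inr ⟨max b b', max_lt hb hb',
    (h.mono (le_max_left _ _)).trans hκ (h'.mono (le_max_right _ _))⟩)

def KEs (hκ : ℵ₀ ≤ κ) (P : Type u) [LinearOrder P] (a : Ordinal.{u}) : Setoid P where
  r := KE κ a
  iseqv := ⟨fun x => KE.refl a x, KE.symm, KE.trans hκ⟩

/-- Transversal: representatives. -/
theorem exists_rep (hκ : ℵ₀ ≤ κ) (P : Type u) [LinearOrder P] (a : Ordinal.{u}) :
    ∃ ρ : P → P, (∀ x, KE κ a x (ρ x)) ∧ ∀ x y, KE κ a x y → ρ x = ρ y := by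
  refine ⟨fun x => (Quotient.mk (KEs hκ P a) x).out, fun x => ?_, fun x y h => ?_⟩
  · exact (Quotient.mk_out (s := KEs hκ P a) x).symm
  · have : (Quotient.mk (KEs hκ P a) x) = Quotient.mk _ y := Quotient.sound h
    simp only [this]

theorem rep_lt (hκ : ℵ₀ ≤ κ) {a : Ordinal.{u}} {ρ : P → P} (h1 : ∀ x, KE κ a x (ρ x))
    {x y : P} (hxy : x < y) (hn : ¬ KE κ a x y) : ρ x < ρ y := by
  by_contra h
  rw [not_lt] at h
  apply hn
  rcases le_total (ρ y) x with h' | h'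
  · have : KE κ a (ρ y) x := (h1 y).symm.sub (Set.mem_uIcc.2 (Or.inl ⟨h', hxy.le⟩))
    exact ((h1 y).trans hκ this).symm
  · have : KE κ a x (ρ y) := (h1 x).sub (Set.mem_uIcc.2 (Or.inl ⟨h', h⟩))
    exact this.trans hκ (h1 y).symm

theorem exists_KE_all (hκ : ℵ₀ ≤ κ) (hP : KScattered κ P) : ∃ a, ∀ x y : P, KE κ a x y := by
  obtain ⟨a, hst⟩ : ∃ a : Ordinal.{u}, ∀ x y : P, KE κ (Order.succ a) x y → KE κ a x y := by
    have := not_injective_of_ordinal (fun a : Ordinal.{u} => {p : P × P | KE κ a p.1 p.2})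
    simp only [Function.Injective, not_forall] at this
    obtain ⟨a, b, hab, hne⟩ := this
    have key : ∀ a b : Ordinal.{u}, a < b →
      {p : P × P | KE κ a p.1 p.2} = {p : P × P | KE κ b p.1 p.2} →
        ∀ x y : P, KE κ (Order.succ a) x y → KE κ a x y := by
      intro a b hlt hab x y h
      have : (x, y) ∈ {p : P × P | KE κ b p.1 p.2} := h.mono (Order.succ_le_of_lt hlt)
      rw [← hab] at this
      exact this
    rcases lt_or_gt_of_ne hne with h | h
    · exact ⟨a, key a b h hab⟩
    · exact ⟨b, key b a h hab.symm⟩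
  refine ⟨a, ?_⟩
  by_contra hcon
  push Not at hcon
  obtain ⟨x0, y0, h0⟩ := hcon
  obtain ⟨ρ, h1, h2⟩ := exists_rep hκ P a
  have hidem : ∀ x, ρ (ρ x) = ρ x := fun x => (h2 _ _ (h1 x)).symm
  refine hP (Set.range ρ) ⟨⟨⟨ρ x0, x0, rfl⟩, ⟨ρ y0, y0, rfl⟩, ?_⟩, ?_⟩
  · intro h
    have h : ρ x0 = ρ y0 := congrArg Subtype.val h
    exact h0 ((h1 x0).trans hκ (h ▸ (h1 y0).symm))
  rintro ⟨x, x', rfl⟩ ⟨y, y', rfl⟩ hxy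
  have hxy : ρ x' < ρ y' := hxy
  by_contra hlt
  rw [not_le] at hlt
  have hnE : ¬ KE κ a (ρ x') (ρ y') := by
    intro h
    have := h2 _ _ h
    rw [hidem, hidem] at this
    exact hxy.ne this
  apply hnE
  apply hst
  refine KE.step _ a (Order.lt_succ a) _ _ ρ ?_ (fun z _ => h1 z)
  have hsub : ρ '' Set.uIcc (ρ x') (ρ y') ⊆ (Subtype.val '' {c : Set.range ρ |
      (⟨ρ x', x', rfl⟩ : Set.range ρ) < c ∧ c < ⟨ρ y', y', rfl⟩}) ∪ {ρ x', ρ y'} := by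
    rintro _ ⟨z, hz, rfl⟩
    rw [Set.uIcc_of_le hxy.le] at hz
    by_cases hzx : ρ z = ρ x'
    · right; simp [hzx]
    by_cases hzy : ρ z = ρ y'
    · right; simp [hzy]
    left
    refine ⟨⟨ρ z, z, rfl⟩, ⟨?_, ?_⟩, rfl⟩
    · have : ¬ KE κ a (ρ x') z := by
        intro h
        exact hzx (by rw [← h2 _ _ h, hidem])
      have hlt : ρ x' < z := lt_of_le_of_ne hz.1 (by rintro h; exact this (h ▸ KE.refl _ _))
      have := rep_lt hκ h1 hlt this
      rw [hidem] at this
      exact this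
    · have : ¬ KE κ a z (ρ y') := by
        intro h
        exact hzy (by rw [h2 _ _ h, hidem])
      have hlt : z < ρ y' := lt_of_le_of_ne hz.2 (by rintro h; exact this (h ▸ KE.refl _ _))
      have := rep_lt hκ h1 hlt this
      rw [hidem] at this
      exact this
  refine (mk_le_mk_of_subset hsub).trans_lt ((mk_union_le _ _).trans_lt (add_lt_of_lt hκ ?_ ?_))
  · exact mk_image_le.trans_lt hlt
  · exact (Set.toFinite _).lt_aleph0.trans_le hκ

/-- The index order of the `b`-classes near `p`. -/
theorem exists_index (hκ : ℵ₀ ≤ κ) {U : Type u} [LinearOrder U] [Zero U]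
    (hU : ∀ (I : Type u) [LinearOrder I] (p : I), (∀ x y : I, #(Set.Icc x y) < κ) →
      ∃ e : I → U, StrictMono e ∧ e p = 0) (p : P) (b : Ordinal.{u}) :
    ∃ v : P → U, v p = 0 ∧ (∀ x y, KN κ b p x → KN κ b p y → x < y → ¬ KE κ b x y → v x < v y) ∧
      ∀ x y, KE κ b x y → v x = v y := by
  classical
  obtain ⟨ρ, h1, h2⟩ := exists_rep hκ P b
  have hidem : ∀ x, ρ (ρ x) = ρ x := fun x => (h2 _ _ (h1 x)).symm
  by_cases hp : KN κ b p p
  swap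
  · refine ⟨fun _ => 0, rfl, ?_, fun _ _ _ => rfl⟩
    intro x y hx
    exact absurd (hx.trans hκ hx.symm) hp
  let I : Set P := {x | x ∈ ρ '' {x | KN κ b p x}}
  obtain ⟨e, he, hep⟩ := hU I ⟨ρ p, p, hp, rfl⟩ (by
    rintro ⟨_, x, hx, rfl⟩ ⟨_, y, hy, rfl⟩
    have hx : KN κ b p x := hx
    have hy : KN κ b p y := hy
    have hxy : KN κ b x y := hx.symm.trans hκ hy
    by_cases hlt : ρ x ≤ ρ y
    swap
    · have hem : IsEmpty (Set.Icc (⟨ρ x, x, hx, rfl⟩ : I) ⟨ρ y, y, hy, rfl⟩) :=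
        ⟨fun z => hlt (z.2.1.trans z.2.2)⟩
      exact (mk_eq_zero_iff.2 hem).trans_lt (aleph0_pos.trans_le hκ)
    obtain ⟨t, ht, htE⟩ := hxy
    have hsub : Subtype.val '' (Set.Icc (⟨ρ x, x, hx, rfl⟩ : I) ⟨ρ y, y, hy, rfl⟩) ⊆
        ρ '' (t '' Set.uIcc x y) ∪ {ρ x, ρ y} := by
      rintro _ ⟨⟨_, z, hz, rfl⟩, ⟨hz1, hz2⟩, rfl⟩
      have hz1 : ρ x ≤ ρ z := hz1
      have hz2 : ρ z ≤ ρ y := hz2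
      by_cases hzx : ρ z = ρ x
      · right; simp [hzx]
      by_cases hzy : ρ z = ρ y
      · right; simp [hzy]
      left
      have hxz : x ≤ z := by
        by_contra h
        rw [not_le] at h
        have : ¬ KE κ b z x := fun h' => hzx (h2 _ _ h')
        exact (rep_lt hκ h1 h this).not_ge hz1
      have hzy' : z ≤ y := by
        by_contra h
        rw [not_le] at h
        have : ¬ KE κ b y z := fun h' => hzy (h2 _ _ h').symm
        exact (rep_lt hκ h1 h this).not_ge hz2
      have hzm : z ∈ Set.uIcc x y := Set.mem_uIcc.2 (Or.inl ⟨hxz, hzy'⟩)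
      exact ⟨t z, ⟨z, hzm, rfl⟩, (h2 _ _ (htE z hzm)).symm⟩
    rw [← mk_image_eq Subtype.val_injective]
    refine (mk_le_mk_of_subset hsub).trans_lt ((mk_union_le _ _).trans_lt (add_lt_of_lt hκ ?_ ?_))
    · exact mk_image_le.trans_lt ht
    · exact (Set.toFinite _).lt_aleph0.trans_le hκ)
  refine ⟨fun x => if h : ρ x ∈ I then e ⟨ρ x, h⟩ else 0, ?_, ?_, ?_⟩
  · have : ρ p ∈ I := ⟨p, hp, rfl⟩
    simp only [this, dif_pos]
    exact hep
  · intro x y hx hy hxy hn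
    have hx' : ρ x ∈ I := ⟨x, hx, rfl⟩
    have hy' : ρ y ∈ I := ⟨y, hy, rfl⟩
    simp only [hx', hy', dif_pos]
    exact he (rep_lt hκ h1 hxy hn)
  · intro x y h
    simp only [h2 x y h]

end KE

/-! ### Part 3: a universal locally small order -/

theorem regular_of_pow {κ : Cardinal.{u}} (hκ : ℵ₀ ≤ κ) (hpow : κ ^< κ = κ) : κ.IsRegular := by
  refine ⟨hκ, ?_⟩
  by_contra h
  rw [not_le] at h
  have h1 := le_powerlt κ h
  rw [hpow] at h1
  exact (lt_power_cof_ord hκ).not_ge h1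

theorem exists_codes {κ : Cardinal.{u}} (hκ : ℵ₀ ≤ κ) (hpow : κ ^< κ = κ) :
    ∃ (K : Type u) (_ : LinearOrder K) (T : K → Type u) (_ : ∀ k, LinearOrder (T k)),
      #K = κ ∧ (∀ k : K, #(Set.Iic k) < κ) ∧ (∀ k, #(T k) < κ) ∧
      ∀ (X : Type u) [LinearOrder X], #X < κ → ∀ k, ∃ k' > k, Nonempty (X ≃o T k') := by
  classical
  set K := κ.ord.ToType with hK
  have hKc : #K = κ := by simp [hK]
  let Code := Σ δ : K, LinearOrder (Set.Iio δ)
  have hLO : ∀ X : Type u, #X < κ → #(LinearOrder X) ≤ κ := by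
    intro X hX
    have h1 : #(LinearOrder X) ≤ #(Set (X × X)) := by
      refine mk_le_of_injective (f := fun l => {p : X × X | l.le p.1 p.2}) ?_
      intro A B h
      apply LinearOrder.ext
      intro x y
      have : (x, y) ∈ {p : X × X | A.le p.1 p.2} ↔ (x, y) ∈ {p : X × X | B.le p.1 p.2} := by
        rw [show {p : X × X | A.le p.1 p.2} = {p : X × X | B.le p.1 p.2} from h]
      exact this
    refine h1.trans ?_
    rw [mk_set]
    have h2 : #(X × X) < κ := by
      rw [mk_prod, lift_id]
      exact mul_lt_of_lt hκ hX hX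
    calc (2 : Cardinal) ^ #(X × X) ≤ κ ^ #(X × X) :=
          power_le_power_right ((natCast_lt_aleph0 (n := 2)).le.trans hκ)
      _ ≤ κ ^< κ := le_powerlt κ h2
      _ = κ := hpow
  have hCode : #Code ≤ κ := by
    rw [mk_sigma]
    refine (Cardinal.sum_le_sum _ (fun _ => κ) (fun δ => hLO _ (kIio δ))).trans ?_
    rw [Cardinal.sum_const', hKc, mul_eq_self hκ]
  have hinj : #(K × Code) ≤ #K := by
    rw [mk_prod, lift_id, lift_id, hKc]
    exact (mul_le_mul_right hCode κ).trans (mul_eq_self hκ).le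
  obtain ⟨j⟩ := hinj
  have hKne : Nonempty K := by
    rw [← mk_ne_zero_iff, hKc]; exact (aleph0_pos.trans_le hκ).ne'
  have : Nonempty Code := ⟨⟨Classical.arbitrary K, inferInstance⟩⟩
  let e : K → Code := fun k => (Function.invFun j k).2
  have he : ∀ a c, e (j (a, c)) = c := by
    intro a c
    simp only [e, Function.leftInverse_invFun j.injective (a, c)]
  have hcof : ∀ (c : Code) (k : K), ∃ k' > k, e k' = c := by
    intro c k
    by_contra h
    push Not at h
    have h1 : #K ≤ #(Set.Iic k) := by
      refine mk_le_of_injective (f := fun a => ⟨j (a, c), ?_⟩) ?_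
      · by_contra h'
        exact h _ (not_le.1 h') (he a c)
      · intro a b hab
        simpa using hab
    have h2 : #(Set.Iic k) < κ := by
      rw [← Set.Iio_insert]
      exact (mk_insert_le).trans_lt (add_lt_of_lt hκ (kIio k) (one_lt_aleph0.trans_le hκ))
    rw [hKc] at h1
    exact h2.not_ge h1
  refine ⟨K, inferInstance, fun k => Set.Iio (e k).1, fun k => (e k).2, hKc, ?_,
    fun k => kIio _, ?_⟩
  · intro k
    rw [← Set.Iio_insert]
    exact (mk_insert_le).trans_lt (add_lt_of_lt hκ (kIio k) (one_lt_aleph0.trans_le hκ))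
  intro X _ hX k
  have ho : (#X).ord < Ordinal.type (α := K) (· < ·) := by
    have : Ordinal.type (α := K) (· < ·) = κ.ord := Ordinal.type_toType _
    rw [this]
    exact ord_lt_ord.2 hX
  let δ : K := Ordinal.enum (α := K) (· < ·) ⟨(#X).ord, ho⟩
  have hδ : #X = #(Set.Iio δ) := by
    have h1 := Ordinal.card_typein (r := ((· < ·) : K → K → Prop)) δ
    rw [Ordinal.typein_enum, card_ord] at h1
    exact h1
  obtain ⟨ψ⟩ := Cardinal.eq.1 hδ
  obtain ⟨k', hk', hek⟩ := hcof ⟨δ, LinearOrder.lift' ψ.symm ψ.symm.injective⟩ k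
  refine ⟨k', hk', ?_⟩
  have key : ∀ c : Code, c = ⟨δ, LinearOrder.lift' ψ.symm ψ.symm.injective⟩ →
      Nonempty (@OrderIso X (Set.Iio c.1) _ c.2.toLE) := by
    rintro _ rfl
    refine ⟨@RelIso.mk _ _ _ _ ψ ?_⟩
    intro a b
    show ψ.symm (ψ a) ≤ ψ.symm (ψ b) ↔ _
    simp
  exact key _ hek

theorem exists_wf_cofinal (I : Type u) [LinearOrder I] :
    ∃ C : Set I, IsCofinal C ∧ WellFounded ((· < ·) : C → C → Prop) := by
  refine ⟨_, isCofinal_setOfPred_imp_lt (WellOrderingRel (α := I)), ?_⟩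
  refine Subrelation.wf (r := InvImage WellOrderingRel Subtype.val) ?_
    (InvImage.wf _ IsWellFounded.wf)
  rintro ⟨x, hx⟩ ⟨y, hy⟩ hxy
  have hxy : x < y := hxy
  rcases trichotomous_of (WellOrderingRel (α := I)) x y with h | h | h
  · exact h
  · exact absurd h hxy.ne
  · exact absurd (hx _ h) hxy.not_gt

theorem exists_univ1 {κ : Cardinal.{u}} (hκ : ℵ₀ ≤ κ) (hpow : κ ^< κ = κ) :
    ∃ (V : Type u) (_ : LinearOrder V), #V ≤ κ ∧ (∀ y : V, #(Set.Iic y) < κ) ∧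
      ∀ (I : Type u) [LinearOrder I], (∀ y : I, #(Set.Iic y) < κ) → ∃ e : I → V, StrictMono e := by
  classical
  have hreg := regular_of_pow hκ hpow
  obtain ⟨K, instK, T, instT, hKc, hIic, hTc, hTu⟩ := exists_codes hκ hpow
  have hbdd : ∀ (X : Type u) (f : X → K), #X < κ → ∃ k, ∀ x, f x < k := by
    intro X f hX
    by_contra h
    push Not at h
    have h1 : #(⋃ x, Set.Iic (f x)) < κ :=
      (card_iUnion_lt_iff_forall_of_isRegular hreg hX).2 fun x => hIic _
    have h2 : (⋃ x, Set.Iic (f x)) = Set.univ := by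
      ext k; simpa using h k
    rw [h2, mk_univ, hKc] at h1
    exact lt_irrefl _ h1
  refine ⟨Σₗ k, T k, inferInstance, ?_, ?_, ?_⟩
  · show #(Σ k, T k) ≤ κ
    rw [mk_sigma]
    refine (Cardinal.sum_le_sum _ (fun _ => κ) (fun δ => (hTc δ).le)).trans ?_
    rw [Cardinal.sum_const', hKc, mul_eq_self hκ]
  · intro y
    have h1 : #(⋃ k, ⋃ (_ : k ∈ Set.Iic y.1),
        Set.range (fun t : T k => (toLex ⟨k, t⟩ : Σₗ k, T k))) < κ :=
      (card_biUnion_lt_iff_forall_of_isRegular hreg (hIic y.1)).2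
        fun k _ => mk_range_le.trans_lt (hTc k)
    refine (mk_le_mk_of_subset ?_).trans_lt h1
    intro z hz
    have hz : z ≤ y := hz
    rw [Sigma.Lex.le_def] at hz
    simp only [Set.mem_iUnion]
    refine ⟨z.1, ?_, z.2, rfl⟩
    rcases hz with h | ⟨h, -⟩
    · exact h.le
    · exact h.le
  · intro I _ hI
    obtain ⟨C, hC, hwf⟩ := exists_wf_cofinal I
    have hne : ∀ x : I, {c : C | x ≤ c}.Nonempty := by
      intro x
      obtain ⟨c, hc, hxc⟩ := hC x
      exact ⟨⟨c, hc⟩, hxc⟩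
    let cx : I → C := fun x => hwf.min _ (hne x)
    have hcx : ∀ x, x ≤ cx x := fun x => hwf.min_mem _ (hne x)
    have hcx' : ∀ (x : I) (c : C), x ≤ c → cx x ≤ c := fun x c h =>
      not_lt.1 (hwf.not_lt_min _ h)
    let fib : C → Set I := fun c => {x | cx x = c}
    have hfib : ∀ c, #(fib c) < κ := by
      intro c
      refine (mk_le_mk_of_subset ?_).trans_lt (hI c)
      rintro x rfl
      exact hcx x
    have hstep : ∀ (c : C) (ih : ∀ c' : C, c' < c → K), ∃ k, Nonempty (fib c ≃o T k) ∧
        ∀ c' h, ih c' h < k := by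
      intro c ih
      obtain ⟨k, hk⟩ := hbdd {c' : C // c' < c} (fun c' => ih c'.1 c'.2) (by
        refine (mk_le_of_injective (f := fun c' => (⟨c'.1.1, c'.2.le⟩ : Set.Iic (c : I))) ?_).trans_lt
          (hI c)
        intro a b hab
        simpa [Subtype.ext_iff] using hab)
      obtain ⟨k', hk', h⟩ := hTu (fib c) (hfib c) k
      exact ⟨k', h, fun c' h => (hk ⟨c', h⟩).trans hk'⟩
    choose G hG1 hG2 using hstep
    let m : C → K := hwf.fix G
    have hm : ∀ c, m c = G c (fun c' _ => m c') := fun c => hwf.fix_eq G c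
    have hm1 : ∀ c, Nonempty (fib c ≃o T (m c)) := by
      intro c; rw [hm]; exact hG1 _ _
    have hm2 : ∀ c c', c' < c → m c' < m c := by
      intro c c' h; rw [hm c]; exact hG2 c (fun c' _ => m c') c' h
    let iso : ∀ c, fib c ≃o T (m c) := fun c => (hm1 c).some
    let e : I → Σₗ k, T k := fun x => toLex ⟨m (cx x), iso (cx x) ⟨x, rfl⟩⟩
    have heq : ∀ c x (hx : cx x = c), e x = toLex ⟨m c, iso c ⟨x, hx⟩⟩ := by
      rintro c x rfl; rfl
    refine ⟨e, ?_⟩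
    intro x y hxy
    rcases (hcx' x (cx y) (hxy.le.trans (hcx y))).lt_or_eq with h | h
    · exact Sigma.Lex.left _ _ (hm2 _ _ h)
    · rw [heq _ x h, heq _ y rfl]
      exact Sigma.Lex.right _ _ ((iso (cx y)).lt_iff_lt.2 hxy)

theorem exists_univ2 {κ : Cardinal.{u}} (hκ : ℵ₀ ≤ κ) (hpow : κ ^< κ = κ) :
    ∃ (U : Type u) (_ : LinearOrder U) (_ : Zero U), #U ≤ κ ∧ (∀ x y : U, #(Set.Icc x y) < κ) ∧
      ∀ (I : Type u) [LinearOrder I] (p : I), (∀ x y : I, #(Set.Icc x y) < κ) →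
        ∃ e : I → U, StrictMono e ∧ e p = 0 := by
  classical
  obtain ⟨V, _, hVc, hVl, hVu⟩ := exists_univ1 hκ hpow
  have h1κ : (1 : Cardinal) < κ := one_lt_aleph0.trans_le hκ
  refine ⟨Vᵒᵈ ⊕ₗ WithBot V, inferInstance, ⟨toLex (Sum.inr ⊥)⟩, ?_, ?_, ?_⟩
  · show #(Vᵒᵈ ⊕ Option V) ≤ κ
    rw [mk_sum, lift_id, lift_id, mk_option]
    exact add_le_of_le hκ hVc (add_le_of_le hκ hVc h1κ.le)
  · have hA : ∀ x : Vᵒᵈ ⊕ₗ WithBot V, #{z : Vᵒᵈ ⊕ₗ WithBot V | x ≤ z ∧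
        ∃ v, z = toLex (Sum.inl v)} < κ := by
      intro x
      obtain ⟨x, rfl⟩ := toLex.surjective x
      rcases x with a | w
      · refine (mk_le_mk_of_subset (t := (fun v => toLex (Sum.inl (OrderDual.toDual v))) ''
          Set.Iic (OrderDual.ofDual a)) ?_).trans_lt (mk_image_le.trans_lt (hVl _))
        rintro _ ⟨h, v, rfl⟩
        exact ⟨OrderDual.ofDual v, OrderDual.ofDual_le_ofDual.2 (Sum.Lex.inl_le_inl_iff.1 h), rfl⟩
      · have : {z : Vᵒᵈ ⊕ₗ WithBot V | toLex (Sum.inr w) ≤ z ∧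
            ∃ v, z = toLex (Sum.inl v)} = ∅ := by
          ext z
          simp only [Set.mem_ofPred_eq, Set.mem_empty_iff_false, iff_false]
          rintro ⟨h, v, rfl⟩
          exact Sum.Lex.not_inr_le_inl h
        rw [this]; simpa using zero_lt_one.trans h1κ
    have hB : ∀ x : Vᵒᵈ ⊕ₗ WithBot V, #{z : Vᵒᵈ ⊕ₗ WithBot V | z ≤ x ∧
        ∃ v, z = toLex (Sum.inr v)} < κ := by
      intro x
      obtain ⟨x, rfl⟩ := toLex.surjective x
      rcases x with a | w
      · have : {z : Vᵒᵈ ⊕ₗ WithBot V | z ≤ toLex (Sum.inl a) ∧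
            ∃ v, z = toLex (Sum.inr v)} = ∅ := by
          ext z
          simp only [Set.mem_ofPred_eq, Set.mem_empty_iff_false, iff_false]
          rintro ⟨h, v, rfl⟩
          exact Sum.Lex.not_inr_le_inl h
        rw [this]; simpa using zero_lt_one.trans h1κ
      · have h2 : #(Set.Iic w) < κ := by
          induction w using WithBot.recBotCoe with
          | bot => simpa using h1κ
          | coe w =>
            refine (mk_le_mk_of_subset (t := insert ⊥ ((fun v : V => (v : WithBot V)) ''
              Set.Iic w)) ?_).trans_lt (mk_insert_le.trans_lt
                (add_lt_of_lt hκ (mk_image_le.trans_lt (hVl w)) h1κ))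
            intro z hz
            induction z using WithBot.recBotCoe with
            | bot => exact Set.mem_insert _ _
            | coe z => exact Or.inr ⟨z, WithBot.coe_le_coe.1 hz, rfl⟩
        refine (mk_le_mk_of_subset (t := (fun v => toLex (Sum.inr v)) ''
          Set.Iic w) ?_).trans_lt (mk_image_le.trans_lt h2)
        rintro _ ⟨h, v, rfl⟩
        exact ⟨v, Sum.Lex.inr_le_inr_iff.1 h, rfl⟩
    intro x y
    refine (mk_le_mk_of_subset ?_).trans_lt ((mk_union_le _ _).trans_lt
      (add_lt_of_lt hκ (hA x) (hB y)))
    rintro z ⟨h1, h2⟩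
    obtain ⟨z, rfl⟩ := toLex.surjective z
    rcases z with v | v
    · exact Or.inl ⟨h1, v, rfl⟩
    · exact Or.inr ⟨h2, v, rfl⟩
  · intro I _ p hI
    obtain ⟨e1, he1⟩ := hVu {x : I // p < x} (by
      intro y
      refine lt_of_le_of_lt ?_ (hI p y)
      refine mk_le_of_injective (f := fun z => ⟨z.1.1, z.1.2.le, z.2⟩) ?_
      intro a b hab
      simpa [Subtype.ext_iff] using hab)
    obtain ⟨e2, he2⟩ := hVu {x : I // x < p}ᵒᵈ (by
      intro y
      refine lt_of_le_of_lt ?_ (hI (OrderDual.ofDual y).1 p)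
      refine mk_le_of_injective (f := fun z => ⟨(OrderDual.ofDual z.1).1,
        OrderDual.ofDual_le_ofDual.2 z.2, (OrderDual.ofDual z.1).2.le⟩) ?_
      intro a b hab
      have : (OrderDual.ofDual a.1).1 = (OrderDual.ofDual b.1).1 := by
        exact congrArg (fun z : Set.Icc (OrderDual.ofDual y).1 p => (z : I)) hab
      exact Subtype.ext (OrderDual.ofDual.injective (Subtype.ext this)))
    let e : I → Vᵒᵈ ⊕ₗ WithBot V := fun x =>
      if h : x < p then toLex (Sum.inl (OrderDual.toDual (e2 (OrderDual.toDual ⟨x, h⟩))))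
      else if h : p < x then toLex (Sum.inr (e1 ⟨x, h⟩ : WithBot V)) else toLex (Sum.inr ⊥)
    refine ⟨e, ?_, ?_⟩
    · intro x y hxy
      rcases lt_trichotomy y p with hy | rfl | hy
      · have hx := hxy.trans hy
        simp only [e, hx, hy, dif_pos]
        refine Sum.Lex.inl_lt_inl_iff.2 ?_
        exact OrderDual.toDual_lt_toDual.2 (he2 (OrderDual.toDual_lt_toDual.2 hxy))
      · simp only [e, hxy, lt_irrefl, dif_pos, dif_neg, not_false_iff]
        exact Sum.Lex.inl_lt_inr _ _
      · rcases lt_trichotomy x p with hx | rfl | hx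
        · simp only [e, hx, hy, hy.not_gt, dif_pos, dif_neg, not_false_iff]
          exact Sum.Lex.inl_lt_inr _ _
        · simp only [e, hy, hy.not_gt, lt_irrefl, dif_pos, dif_neg, not_false_iff]
          exact Sum.Lex.inr_lt_inr_iff.2 (WithBot.bot_lt_coe _)
        · simp only [e, hx, hx.not_gt, hy, hy.not_gt, dif_pos, dif_neg, not_false_iff]
          exact Sum.Lex.inr_lt_inr_iff.2 (WithBot.coe_lt_coe.2 (he1 hxy))
    · simp only [e, lt_irrefl, dif_neg, not_false_iff]
      rfl

/-! ### Part 4: the target order and the embedding -/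

section target
variable {κ : Cardinal.{u}} {L U : Type u} [LinearOrder L] [LinearOrder U] [Zero U]

theorem target_scattered [WellFoundedLT L] (hκ : ℵ₀ ≤ κ) (hU : ∀ x y : U, #(Set.Icc x y) < κ) :
    KScattered κ (Colex (L →₀ U)) := by
  rintro S ⟨hnt, hS⟩
  let D : Set L := {l | ∃ x y : S, (∀ j, l < j → ofColex x.1 j = ofColex y.1 j) ∧
    ofColex x.1 l < ofColex y.1 l}
  have hD : D.Nonempty := by
    obtain ⟨x, y, hxy⟩ := exists_pair_lt S
    have hxy : x.1 < y.1 := hxy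
    rw [Finsupp.Colex.lt_iff] at hxy
    obtain ⟨l, h1, h2⟩ := hxy
    exact ⟨l, x, y, h1, h2⟩
  obtain ⟨l, ⟨x, y, h1, h2⟩, hmin⟩ := WellFounded.has_min (wellFounded_lt (α := L)) D hD
  have hxy : x < y := by
    show x.1 < y.1
    rw [Finsupp.Colex.lt_iff]
    exact ⟨l, h1, h2⟩
  -- points of `S` which differ, differ at some coordinate `≥ l`
  have hdiff : ∀ z w : S, z < w → ∃ j, l ≤ j ∧ (∀ i, j < i → ofColex z.1 i = ofColex w.1 i) ∧
      ofColex z.1 j < ofColex w.1 j := by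
    intro z w hzw
    have hzw : z.1 < w.1 := hzw
    rw [Finsupp.Colex.lt_iff] at hzw
    obtain ⟨j, h3, h4⟩ := hzw
    exact ⟨j, not_lt.1 (hmin j ⟨z, w, h3, h4⟩), h3, h4⟩
  have hz : ∀ z : S, x < z → z < y → (∀ j, l < j → ofColex z.1 j = ofColex x.1 j) ∧
      ofColex x.1 l ≤ ofColex z.1 l ∧ ofColex z.1 l ≤ ofColex y.1 l := by
    intro z hxz hzy
    obtain ⟨j, hj, h3, h4⟩ := hdiff x z hxz
    obtain ⟨i, hi, h5, h6⟩ := hdiff z y hzy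
    have hjl : j = l := by
      by_contra hne
      have hlj : l < j := lt_of_le_of_ne hj (Ne.symm hne)
      rcases lt_trichotomy i j with h | h | h
      · have := h5 j h
        rw [this, ← h1 j hlj] at h4
        exact lt_irrefl _ h4
      · subst h
        have := h4.trans h6
        rw [h1 i hlj] at this
        exact lt_irrefl _ this
      · have := h3 i h
        rw [← this, h1 i (hlj.trans h)] at h6
        exact lt_irrefl _ h6
    subst hjl
    have hij : i = j := by
      by_contra hne
      have hlj : j < i := lt_of_le_of_ne hi (Ne.symm hne)
      rw [← h3 i hlj, h1 i hlj] at h6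
      exact lt_irrefl _ h6
    subst hij
    exact ⟨fun k hk => (h3 k hk).symm, h4.le, h6.le⟩
  refine (hS x y hxy).not_gt (lt_of_le_of_lt ?_ (hU (ofColex x.1 l) (ofColex y.1 l)))
  refine mk_le_of_injective (f := fun z => ⟨ofColex z.1.1 l, (hz z.1 z.2.1 z.2.2).2⟩) ?_
  intro z w hzw
  have hzw : ofColex z.1.1 l = ofColex w.1.1 l :=
    congrArg (fun z : Set.Icc (ofColex x.1 l) (ofColex y.1 l) => (z : U)) hzw
  have key : ∀ z w : {c : S // x < c ∧ c < y}, ofColex z.1.1 l = ofColex w.1.1 l → ¬ z.1 < w.1 := by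
    intro z w hzw hlt
    obtain ⟨j, hj, h3, h4⟩ := hdiff _ _ hlt
    rcases hj.lt_or_eq with h | h
    · rw [(hz z.1 z.2.1 z.2.2).1 j h, (hz w.1 w.2.1 w.2.2).1 j h] at h4
      exact lt_irrefl _ h4
    · subst h
      rw [hzw] at h4
      exact lt_irrefl _ h4
  exact Subtype.ext (le_antisymm (not_lt.1 (key w z hzw.symm)) (not_lt.1 (key z w hzw)))

noncomputable def qpt : List L → List U → (L →₀ U)
  | x :: s, v :: us => (qpt s us).update x v
  | _, _ => 0

theorem qpt_zero (s : List L) (us : List U) (l : L) (h : ∀ x ∈ s, l < x) : qpt s us l = 0 := by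
  induction s generalizing us with
  | nil => simp [qpt]
  | cons x s ih =>
    cases us with
    | nil => simp [qpt]
    | cons v us =>
      classical
      have h1 : l ≠ x := (h x (by simp)).ne
      simp only [qpt, Finsupp.update_apply, if_neg h1]
      exact ih us fun y hy => h y (by simp [hy])

theorem embed_step {P : Type u} [LinearOrder P] (hκ : ℵ₀ ≤ κ)
    (hU : ∀ (I : Type u) [LinearOrder I] (p : I), (∀ x y : I, #(Set.Icc x y) < κ) →
      ∃ e : I → U, StrictMono e ∧ e p = 0) {ν : Type u}
    (f : Colex (L →₀ U) → ν) (A : Set ν) (c : ℕ → List U → ν) (hcA : ∀ n us, c n us ∈ A)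
    (a : Ordinal.{u}) :
    ∀ (s : List L) (us : List U),
      SEmb (fun s us => f (toColex (qpt s us))) c a s → f (toColex (qpt s us)) ∈ A →
      ∀ C : Set P, (∀ x ∈ C, ∀ y ∈ C, KE κ a x y) → ∃ h : P → Colex (L →₀ U),
        StrictMonoOn h C ∧ (∀ x ∈ C, f (h x) ∈ A) ∧
          ∀ x ∈ C, ∀ l, ¬ (∀ y ∈ s, l < y) → ofColex (h x) l = qpt s us l := by
  classical
  induction a using WellFoundedLT.induction with
  | ind a ih =>
  intro s us hE hA C hC
  obtain ⟨_, _, g, hm, hl, hc, hr⟩ := hE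
  rcases C.eq_empty_or_nonempty with rfl | ⟨p, hp⟩
  · exact ⟨fun _ => toColex 0, by simp [StrictMonoOn], by simp, by simp⟩
  choose v hv0 hvlt hveq using fun b => exists_index (P := P) hκ hU p b
  have hex : ∀ x ∈ C, x ≠ p → ∃ b < a, KN κ b p x := fun x hx hne =>
    (KE_iff.1 (hC p hp x hx)).resolve_left (Ne.symm hne)
  let rb : P → Ordinal.{u} := fun x => sInf {b | KN κ b p x}
  have hrb : ∀ x ∈ C, x ≠ p → rb x < a ∧ KN κ (rb x) p x ∧ ¬ KE κ (rb x) p x := by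
    intro x hx hne
    obtain ⟨b, hb, hN⟩ := hex x hx hne
    refine ⟨(csInf_le' (s := {b | KN κ b p x}) hN).trans_lt hb,
      csInf_mem (s := {b | KN κ b p x}) ⟨b, hN⟩, ?_⟩
    intro hK
    rcases KE_iff.1 hK with h | ⟨b', hb', hN'⟩
    · exact hne h.symm
    · exact (csInf_le' (s := {b | KN κ b p x}) hN').not_gt hb'
  have hrb_le : ∀ x b, KN κ b p x → rb x ≤ b := fun x b h =>
    csInf_le' (s := {b | KN κ b p x}) h
  have hIH : ∀ (b : Ordinal.{u}) (w : U), ∃ h : P → Colex (L →₀ U), b < a →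
        StrictMonoOn h {x | x ∈ C ∧ x ≠ p ∧ rb x = b ∧ v b x = w} ∧ (∀ x ∈ {x | x ∈ C ∧ x ≠ p ∧ rb x = b ∧ v b x = w}, f (h x) ∈ A) ∧
          ∀ x ∈ {x | x ∈ C ∧ x ≠ p ∧ rb x = b ∧ v b x = w}, ∀ l, ¬ (∀ y ∈ g b :: s, l < y) →
            ofColex (h x) l = qpt (g b :: s) (w :: us) l := by
    intro b w
    by_cases hb : b < a
    swap
    · exact ⟨fun _ => toColex 0, fun h => absurd h hb⟩
    obtain ⟨h, hh⟩ := ih b hb (g b :: s) (w :: us) (hr b hb)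
      (by
        have := congrFun (hc b hb) (w :: us)
        rw [this]; exact hcA _ _)
      {x | x ∈ C ∧ x ≠ p ∧ rb x = b ∧ v b x = w} (by
        rintro x ⟨hx, hxp, rfl, hxw⟩ y ⟨hy, hyp, hyb, hyw⟩
        by_contra hn
        have hx' := (hrb x hx hxp).2.1
        have hy' := (hrb y hy hyp).2.1
        rw [hyb] at hy'
        rcases lt_trichotomy x y with h | h | h
        · have := hvlt _ x y hx' hy' h hn
          rw [hxw, hyw] at this
          exact lt_irrefl _ this
        · exact hn (h ▸ KE.refl _ _)
        · have := hvlt _ y x hy' hx' h (fun h' => hn h'.symm)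
          rw [hxw, hyw] at this
          exact lt_irrefl _ this)
    exact ⟨h, fun _ => hh⟩
  choose hh hhh using hIH
  let h : P → Colex (L →₀ U) := fun x =>
    if x = p then toColex (qpt s us) else hh (rb x) (v (rb x) x) x
  have hhp : h p = toColex (qpt s us) := by simp [h]
  have hhx : ∀ x, x ≠ p → h x = hh (rb x) (v (rb x) x) x := fun x hx => by simp [h, hx]
  have hgt : ∀ x ∈ C, x ≠ p → ∀ l, g (rb x) < l → ofColex (h x) l = qpt s us l := by
    intro x hx hne l hlt
    rw [hhx x hne, (hhh (rb x) (v (rb x) x) (hrb x hx hne).1).2.2 x ⟨hx, hne, rfl, rfl⟩ l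
      (fun h => (h (g (rb x)) (by simp)).not_gt hlt)]
    simp [qpt, Finsupp.update_apply, hlt.ne']
  have hat : ∀ x ∈ C, x ≠ p → ofColex (h x) (g (rb x)) = v (rb x) x := by
    intro x hx hne
    rw [hhx x hne, (hhh (rb x) (v (rb x) x) (hrb x hx hne).1).2.2 x ⟨hx, hne, rfl, rfl⟩ _
      (fun h => lt_irrefl _ (h (g (rb x)) (by simp)))]
    simp [qpt, Finsupp.update_apply]
  have hg0 : ∀ b < a, qpt s us (g b) = 0 := fun b hb => qpt_zero s us _ (hl b hb)
  have hpos : ∀ x ∈ C, p < x → 0 < v (rb x) x := by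
    intro x hx hlt
    obtain ⟨h1, h2, h3⟩ := hrb x hx hlt.ne'
    rw [← hv0 (rb x)]
    exact hvlt _ p x (h2.sub (Set.uIcc_subset_uIcc Set.left_mem_uIcc Set.left_mem_uIcc)) h2 hlt h3
  have hneg : ∀ x ∈ C, x < p → v (rb x) x < 0 := by
    intro x hx hlt
    obtain ⟨h1, h2, h3⟩ := hrb x hx hlt.ne
    rw [← hv0 (rb x)]
    exact hvlt _ x p h2 (h2.sub (Set.uIcc_subset_uIcc Set.left_mem_uIcc Set.left_mem_uIcc)) hlt
      (fun h => h3 h.symm)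
  refine ⟨h, ?_, ?_, ?_⟩
  · intro x hx y hy hxy
    by_cases hxp : x = p
    · subst hxp
      rw [Finsupp.Colex.lt_iff]
      refine ⟨g (rb y), fun j hj => ?_, ?_⟩
      · rw [hgt y hy hxy.ne' j hj, hhp]; rfl
      · rw [hat y hy hxy.ne', hhp]
        show qpt s us _ < _
        rw [hg0 _ (hrb y hy hxy.ne').1]
        exact hpos y hy hxy
    by_cases hyp : y = p
    · subst hyp
      rw [Finsupp.Colex.lt_iff]
      refine ⟨g (rb x), fun j hj => ?_, ?_⟩
      · rw [hgt x hx hxy.ne j hj, hhp]; rfl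
      · rw [hat x hx hxy.ne, hhp]
        show _ < qpt s us _
        rw [hg0 _ (hrb x hx hxy.ne).1]
        exact hneg x hx hxy
    obtain ⟨hx1, hx2, hx3⟩ := hrb x hx hxp
    obtain ⟨hy1, hy2, hy3⟩ := hrb y hy hyp
    rcases lt_trichotomy (rb x) (rb y) with hb | hb | hb
    · have hpy : p < y := by
        by_contra hn
        have hyp' : y ≤ p := not_lt.1 hn
        refine (hrb_le y (rb x) (hx2.sub (Set.uIcc_subset_uIcc Set.left_mem_uIcc ?_))).not_gt hb
        exact Set.mem_uIcc.2 (Or.inr ⟨hxy.le, hyp'⟩)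
      have hgg : g (rb x) < g (rb y) := hm hx1 hy1 hb
      rw [Finsupp.Colex.lt_iff]
      refine ⟨g (rb y), fun j hj => ?_, ?_⟩
      · rw [hgt y hy hyp j hj, hgt x hx hxp j (hgg.trans hj)]
      · rw [hat y hy hyp, hgt x hx hxp _ hgg, hg0 _ hy1]
        exact hpos y hy hpy
    · by_cases hvv : v (rb x) x = v (rb y) y
      · rw [hhx x hxp, hhx y hyp, hvv, hb]
        exact (hhh (rb y) (v (rb y) y) hy1).1 ⟨hx, hxp, hb, by rw [← hvv, hb]⟩
          ⟨hy, hyp, rfl, rfl⟩ hxy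
      · rw [Finsupp.Colex.lt_iff]
        refine ⟨g (rb y), fun j hj => ?_, ?_⟩
        · rw [hgt y hy hyp j hj, hgt x hx hxp j (hb ▸ hj)]
        · rw [hat y hy hyp, ← hb, hat x hx hxp]
          have hne : ¬ KE κ (rb x) x y := fun hK => hvv (by rw [← hb]; exact hveq _ _ _ hK)
          exact hvlt _ x y hx2 (hb ▸ hy2) hxy hne
    · have hpx : x < p := by
        by_contra hn
        have hxp' : p ≤ x := not_lt.1 hn
        refine (hrb_le x (rb y) (hy2.sub (Set.uIcc_subset_uIcc Set.left_mem_uIcc ?_))).not_gt hb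
        exact Set.mem_uIcc.2 (Or.inl ⟨hxp', hxy.le⟩)
      have hgg : g (rb y) < g (rb x) := hm hy1 hx1 hb
      rw [Finsupp.Colex.lt_iff]
      refine ⟨g (rb x), fun j hj => ?_, ?_⟩
      · rw [hgt x hx hxp j hj, hgt y hy hyp j (hgg.trans hj)]
      · rw [hat x hx hxp, hgt y hy hyp _ hgg, hg0 _ hx1]
        exact hneg x hx hpx
  · intro x hx
    by_cases hxp : x = p
    · rw [hxp, hhp]; exact hA
    · rw [hhx x hxp]
      exact (hhh _ _ (hrb x hx hxp).1).2.1 x ⟨hx, hxp, rfl, rfl⟩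
  · intro x hx l hnl
    by_cases hxp : x = p
    · rw [hxp, hhp]; rfl
    · apply hgt x hx hxp
      push Not at hnl
      obtain ⟨y, hy, hyl⟩ := hnl
      exact (hl _ (hrb x hx hxp).1 y hy).trans_le hyl

end target

/-- Suppose `κ` is an infinite cardinal with `κ^{<κ} = κ`, `φ` is a
`κ`-scattered linear order type (represented by a linear order `P`), and `ν` is a
cardinal (represented by a type of colors `ν`).  Then there is a `κ`-scattered linear
order type `ψ` (represented by `Q`) such that `ψ → [φ]¹_{ν, κ}`: for every coloring
`f : Q → ν` there are a set `A` of at most `κ` colors and a suborder of `Q`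
order-isomorphic to `P` whose image under `f` is contained in `A`. -/
theorem stmt19 (κ : Cardinal.{u}) (hκ : ℵ₀ ≤ κ) (hpow : κ ^< κ = κ)
    (P : Type u) [LinearOrder P] (hP : KScattered κ P) (ν : Type u) :
    ∃ (Q : Type u) (_ : LinearOrder Q), KScattered κ Q ∧
      ∀ f : Q → ν, ∃ A : Set ν, #A ≤ κ ∧
        ∃ S : Set Q, Nonempty (P ≃o S) ∧ ∀ x ∈ S, f x ∈ A := by
  obtain ⟨U, _, _, hUc, hUl, hUu⟩ := exists_univ2 hκ hpow
  obtain ⟨α, hα⟩ := exists_KE_all hκ hP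
  obtain ⟨L, _, _, _, hL⟩ := tree_partition (List U → ν) α
  refine ⟨Colex (L →₀ U), inferInstance, target_scattered hκ hUl, fun f => ?_⟩
  obtain ⟨c, hc⟩ := hL (fun s us => f (toColex (qpt s us)))
  let A : Set ν := insert (f (toColex (qpt [] []))) (Set.range fun q : ℕ × List U => c q.1 q.2)
  refine ⟨A, ?_, ?_⟩
  · refine mk_insert_le.trans (add_le_of_le hκ ?_ (one_lt_aleph0.le.trans hκ))
    have h1 : #(List U) ≤ κ := (mk_list_le_max U).trans (max_le hκ hUc)
    have h2 : #(Set.range fun q : ℕ × List U => c q.1 q.2) ≤ max ℵ₀ κ := by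
      have h3 := mk_range_le_lift (f := fun q : ℕ × List U => c q.1 q.2)
      simp only [mk_prod, lift_id, lift_uzero, mk_nat, lift_aleph0] at h3
      exact h3.trans ((mul_le_mul' hκ h1).trans ((mul_eq_self hκ).le.trans (le_max_right _ _)))
    exact h2.trans (max_le hκ le_rfl)
  · obtain ⟨h, h1, h2, -⟩ := embed_step (P := P) hκ hUu f A c
      (fun n us => Set.mem_insert_of_mem _ ⟨(n, us), rfl⟩) α [] [] hc (Set.mem_insert _ _)
      Set.univ (fun x _ y _ => hα x y)
    refine ⟨Set.range h, ⟨StrictMono.orderIso h (fun x y hxy => h1 trivial trivial hxy)⟩, ?_⟩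
    rintro _ ⟨x, rfl⟩
    exact h2 x trivial
end
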